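/- Let X_free be a compact, path-connected subset of ℝ² equal to a finite union of convex polygons, and let ζ ≥ 0. Let ς_s and ς_g be paths in X_free of finite cost, both starting at x⋆, with c(ς_s) ≤ ζ and c(ς_g) ≤ ζ. Let σ* be an optimal homotopic path in X_free with σ* ≃_p ς̄_s * ς_g. Then for every t ∈ [0,1], m[ς_s * σ*_{[0,t]}] ≤ ζ; that is, moving along σ* from ς_s(1) to ς_g(1) keeps the taut tether length within the bound ζ at all times. -/

import Mathlib

noncomputable section

/-- Points of the plane. -/
abbrev E2 : Type := EuclideanSpace ℝ (Fin 2)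

namespace THPP

lemma subIcc_mem (s t₁ t₂ : unitInterval) :
    (1 - s.1) * t₁.1 + s.1 * t₂.1 ∈ Set.Icc (0 : ℝ) 1 := by
  have hs0 : (0:ℝ) ≤ s.1 := s.2.1
  have hs1 : s.1 ≤ 1 := s.2.2
  have ha0 : (0:ℝ) ≤ t₁.1 := t₁.2.1
  have ha1 : t₁.1 ≤ 1 := t₁.2.2
  have hb0 : (0:ℝ) ≤ t₂.1 := t₂.2.1
  have hb1 : t₂.1 ≤ 1 := t₂.2.2
  constructor
  · have h1 := mul_nonneg (by linarith : (0:ℝ) ≤ 1 - s.1) ha0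
    have h2 := mul_nonneg hs0 hb0
    linarith
  · have h1 := mul_nonneg (by linarith : (0:ℝ) ≤ 1 - s.1) (by linarith : (0:ℝ) ≤ 1 - t₁.1)
    have h2 := mul_nonneg hs0 (by linarith : (0:ℝ) ≤ 1 - t₂.1)
    nlinarith

/-- The subpath `σ_{[t₁,t₂]} : s ↦ σ ((1-s)·t₁ + s·t₂)`. -/
def subpath {Y : Type*} [TopologicalSpace Y] {a b : Y} (σ : Path a b) (t₁ t₂ : unitInterval) :
    Path (σ t₁) (σ t₂) where
  toFun s := σ ⟨(1 - s.1) * t₁.1 + s.1 * t₂.1, subIcc_mem s t₁ t₂⟩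
  continuous_toFun := σ.continuous.comp (Continuous.subtype_mk (by fun_prop) _)
  source' := by
    exact congrArg (fun u => σ u) (Subtype.ext (by simp))
  target' := by
    exact congrArg (fun u => σ u) (Subtype.ext (by simp))

/-- The subpath `σ_{[0,t]}`, as a path from the start point of `σ` to `σ t`. -/
def subpath0 {Y : Type*} [TopologicalSpace Y] {a b : Y} (σ : Path a b) (t : unitInterval) :
    Path a (σ t) :=
  (subpath σ 0 t).cast σ.source.symm rfl

/-- The straight-line path `t ↦ (1-t)·x₀ + t·x₁`, as a path in `X` given that the
segment `[x₀, x₁]` is contained in `X`. -/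
def linePath {X : Set E2} {x₀ x₁ : E2} (h₀ : x₀ ∈ X) (h₁ : x₁ ∈ X)
    (hseg : segment ℝ x₀ x₁ ⊆ X) : Path (⟨x₀, h₀⟩ : X) ⟨x₁, h₁⟩ where
  toFun t := ⟨(1 - t.1) • x₀ + t.1 • x₁,
    hseg (by rw [segment_eq_image]; exact ⟨t.1, t.2, rfl⟩)⟩
  continuous_toFun := Continuous.subtype_mk (by fun_prop) _
  source' := Subtype.ext (by simp)
  target' := Subtype.ext (by simp)

/-- The cost (arc length) of a path in a subset of the plane: the total variation of the
underlying map `[0,1] → ℝ²`. -/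
def cost {X : Set E2} {a b : X} (σ : Path a b) : ENNReal :=
  eVariationOn (fun t => (σ t : E2)) Set.univ

/-- A path is an optimal homotopic path if it has minimal cost within its
path-homotopy class (homotopies staying in `X`). -/
def IsOptimal {X : Set E2} {a b : X} (σ : Path a b) : Prop :=
  ∀ σ' : Path a b, σ.Homotopic σ' → cost σ ≤ cost σ'

/-- `m[σ]`: the infimal cost of the path-homotopy class of `σ`. -/
def mCost {X : Set E2} {a b : X} (σ : Path a b) : ENNReal :=
  ⨅ σ' : {σ' : Path a b // σ.Homotopic σ'}, cost σ'.1

/-- Concatenation `σ₀ * σ₁ * ⋯ * σ_{n-1}` of a chain of paths. -/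
def chain {Y : Type*} [TopologicalSpace Y] (x : ℕ → Y)
    (σ : ∀ i : ℕ, Path (x i) (x (i + 1))) : ∀ n : ℕ, Path (x 0) (x n)
  | 0 => Path.refl (x 0)
  | n + 1 => (chain x σ n).trans (σ n)


section

/-- cone -/
def IsCone (C : Set E2) : Prop := ∀ v ∈ C, ∀ s : ℝ, 0 ≤ s → s • v ∈ C

def Vis (C : Set E2) (a b : E2) : Prop := segment ℝ a b ⊆ C

lemma Vis.symm {C : Set E2} {a b : E2} (h : Vis C a b) : Vis C b a := by
  unfold Vis; rw [segment_symm]; exact h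

lemma vis_iff {C : Set E2} {a b : E2} :
    Vis C a b ↔ ∀ x y : ℝ, 0 ≤ x → 0 ≤ y → x + y = 1 → x • a + y • b ∈ C := by
  constructor
  · intro h x y hx hy hxy
    exact h ⟨x, y, hx, hy, hxy, rfl⟩
  · rintro h _ ⟨x, y, hx, hy, hxy, rfl⟩
    exact h x y hx hy hxy

lemma Vis.cone {C : Set E2} (hC : IsCone C) {a b : E2} (h : Vis C a b) {x y : ℝ}
    (hx : 0 ≤ x) (hy : 0 ≤ y) : x • a + y • b ∈ C := by
  rcases (add_nonneg hx hy).eq_or_lt' with h0 | h0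
  · have hx0 : x = 0 := by linarith
    have hy0 : y = 0 := by linarith
    have := hC a (h (left_mem_segment ℝ a b)) 0 le_rfl
    simpa [hx0, hy0] using this
  · have := hC _ (vis_iff.1 h (x / (x + y)) (y / (x + y)) (by positivity) (by positivity)
      (by field_simp)) (x + y) h0.le
    convert this using 1
    rw [smul_add, smul_smul, smul_smul]
    congr 2 <;> field_simp

/-- visibility inside the cone spanned by a visible pair -/
lemma Vis.sub {C : Set E2} (hC : IsCone C) {a b : E2} (h : Vis C a b) {x y z w : ℝ}
    (hx : 0 ≤ x) (hy : 0 ≤ y) (hz : 0 ≤ z) (hw : 0 ≤ w) :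
    Vis C (x • a + y • b) (z • a + w • b) := by
  rw [vis_iff]
  intro s t hs ht _
  have := h.cone hC (x := s * x + t * z) (y := s * y + t * w) (by positivity) (by positivity)
  convert this using 1
  module

lemma vis_zero {C : Set E2} (hC : IsCone C) {a : E2} (ha : a ∈ C) : Vis C a 0 := by
  rw [vis_iff]
  intro s t hs ht _
  simpa using hC a ha s hs

lemma vis_ray {C : Set E2} (hC : IsCone C) {a : E2} (ha : a ∈ C) {x y : ℝ} (hx : 0 ≤ x)
    (hy : 0 ≤ y) : Vis C (x • a) (y • a) := by
  rw [vis_iff]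
  intro s t hs ht _
  have := hC a ha (s * x + t * y) (by positivity)
  convert this using 1
  module

lemma exists_rel (a b c : E2) : ∃ x y z : ℝ, (x ≠ 0 ∨ y ≠ 0 ∨ z ≠ 0) ∧
    x • a + y • b + z • c = 0 := by
  by_contra hcon
  push Not at hcon
  have hli : LinearIndependent ℝ ![a, b, c] := by
    rw [Fintype.linearIndependent_iff]
    intro g hg
    simp only [Fin.sum_univ_three, Matrix.cons_val_zero, Matrix.cons_val_one,
      Matrix.cons_val_two, Matrix.head_cons, Matrix.tail_cons, Matrix.cons_val] at hg
    by_cases h0 : g 0 ≠ 0 ∨ g 1 ≠ 0 ∨ g 2 ≠ 0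
    · exact absurd hg (hcon _ _ _ h0)
    · push Not at h0
      intro i
      fin_cases i
      exacts [h0.1, h0.2.1, h0.2.2]
  have := hli.fintype_card_le_finrank
  simp at this

/-- the key angle inequality -/
lemma key_angle {C : Set E2} (hC : IsCone C) {a b c : E2} (hab : Vis C a b) (hbc : Vis C b c)
    (hac : ¬ Vis C a c) : ‖c‖ * inner ℝ b a + ‖a‖ * inner ℝ b c ≤ 0 := by
  have haC : a ∈ C := hab (left_mem_segment ℝ _ _)
  have hcC : c ∈ C := hbc (right_mem_segment ℝ _ _)
  have ha0 : a ≠ 0 := by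
    rintro rfl; exact hac (vis_zero hC hcC).symm
  have hc0 : c ≠ 0 := by
    rintro rfl; exact hac (vis_zero hC haC)
  have hna : 0 < ‖a‖ := norm_pos_iff.2 ha0
  have hnc : 0 < ‖c‖ := norm_pos_iff.2 hc0
  have hcs : -(‖a‖ * ‖c‖) ≤ inner ℝ a c := by
    have := abs_real_inner_le_norm a c
    exact neg_le_of_abs_le this
  -- core computation
  have core : ∀ x y z : ℝ, (x ≠ 0 ∨ y ≠ 0 ∨ z ≠ 0) → x • a + y • b + z • c = 0 →
      0 ≤ x → 0 ≤ y → 0 ≤ z → ‖c‖ * inner ℝ b a + ‖a‖ * inner ℝ b c ≤ 0 := by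
    intro x y z hne hrel hx hy hz
    have e1 : x * ‖a‖ ^ 2 + y * inner ℝ b a + z * inner ℝ a c = 0 := by
      have := congrArg (fun v => inner ℝ v a) hrel
      simp only [inner_add_left, inner_smul_left, inner_zero_left, real_inner_self_eq_norm_sq,
        RCLike.conj_to_real] at this
      rw [real_inner_comm c a]
      linarith
    have e2 : x * inner ℝ a c + y * inner ℝ b c + z * ‖c‖ ^ 2 = 0 := by
      have := congrArg (fun v => inner ℝ v c) hrel
      simp only [inner_add_left, inner_smul_left, inner_zero_left, real_inner_self_eq_norm_sq,
        RCLike.conj_to_real] at this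
      linarith
    rcases hy.eq_or_lt with hy0 | hy0
    · -- x a + z c = 0
      subst hy0
      have hrel' : x • a = (-z) • c := by
        have : x • a + z • c = 0 := by simpa using hrel
        rw [neg_smul]; exact eq_neg_of_add_eq_zero_left this
      have hn : x * ‖a‖ = z * ‖c‖ := by
        have := congrArg norm hrel'
        simpa [norm_smul, abs_of_nonneg hx, abs_of_nonneg hz] using this
      have hx0 : 0 < x := by
        rcases hx.eq_or_lt with h | h
        · exfalso
          subst h
          have : z = 0 := by
            have : z * ‖c‖ = 0 := by linarith
            rcases mul_eq_zero.1 this with h | h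
            · exact h
            · exact absurd h hnc.ne'
          simp [this] at hne
        · exact h
      have hi : x * inner ℝ b a = - z * inner ℝ b c := by
        have := congrArg (fun v => inner ℝ b v) hrel'
        simpa only [inner_smul_right] using this
      have : x * (‖c‖ * inner ℝ b a + ‖a‖ * inner ℝ b c) = 0 := by
        calc _ = ‖c‖ * (x * inner ℝ b a) + (x * ‖a‖) * inner ℝ b c := by ring
          _ = 0 := by rw [hi, hn]; ring
      rcases mul_eq_zero.1 this with h | h
      · exact absurd h hx0.ne'
      · exact h.le
    · have : y * (‖c‖ * inner ℝ b a + ‖a‖ * inner ℝ b c) =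
          -((x * ‖a‖ + z * ‖c‖) * (‖a‖ * ‖c‖ + inner ℝ a c)) := by
        linear_combination ‖c‖ * e1 + ‖a‖ * e2
      have h2 : 0 ≤ (x * ‖a‖ + z * ‖c‖) * (‖a‖ * ‖c‖ + inner ℝ a c) :=
        mul_nonneg (by positivity) (by linarith)
      by_contra hpos
      push Not at hpos
      have := mul_pos hy0 hpos
      linarith
  have main : ∀ x y z : ℝ, (x ≠ 0 ∨ y ≠ 0 ∨ z ≠ 0) → x • a + y • b + z • c = 0 →
      0 ≤ y → ‖c‖ * inner ℝ b a + ‖a‖ * inner ℝ b c ≤ 0 := by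
    intro x y z hne hrel hy
    rcases le_or_gt 0 x with hx | hx <;> rcases le_or_gt 0 z with hz | hz
    · exact core x y z hne hrel hx hy hz
    · exfalso; apply hac
      have hc : c = (x / (-z)) • a + (y / (-z)) • b := by
        have : (-z) • c = x • a + y • b := by
          rw [neg_smul]; exact (eq_neg_of_add_eq_zero_left hrel).symm
        rw [div_eq_inv_mul, div_eq_inv_mul, mul_smul, mul_smul, ← smul_add, ← this, smul_smul,
          inv_mul_cancel₀ (by linarith), one_smul]
      have := hab.sub hC (x := 1) (y := 0) (z := x / (-z)) (w := y / (-z)) zero_le_one le_rfl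
        (div_nonneg hx (by linarith)) (div_nonneg hy (by linarith))
      rw [← hc] at this
      simpa using this
    · exfalso; apply hac
      have hc : a = (y / (-x)) • b + (z / (-x)) • c := by
        have : (-x) • a = y • b + z • c := by
          rw [neg_smul]; rw [add_assoc] at hrel; exact neg_eq_of_add_eq_zero_right hrel
        rw [div_eq_inv_mul, div_eq_inv_mul, mul_smul, mul_smul, ← smul_add, ← this, smul_smul,
          inv_mul_cancel₀ (by linarith), one_smul]
      have := hbc.sub hC (z := 0) (w := 1) (x := y / (-x)) (y := z / (-x))
        (div_nonneg hy (by linarith)) (div_nonneg hz (by linarith)) le_rfl zero_le_one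
      rw [← hc] at this
      simpa using this
    · rcases hy.eq_or_lt with hy0 | hy0
      · refine core (-x) 0 (-z) (Or.inl (by linarith [neg_pos.2 hx] : -x ≠ 0)) ?_ (by linarith)
          le_rfl (by linarith)
        subst hy0
        have : -(x • a + (0:ℝ) • b + z • c) = 0 := by rw [hrel, neg_zero]
        rw [← this]; module
      · exfalso; apply hac
        rw [vis_iff]
        intro s t hs ht _
        set p := (-x) / y with hp
        set q := (-z) / y with hq
        have hp0 : 0 < p := div_pos (by linarith) hy0
        have hq0 : 0 < q := div_pos (by linarith) hy0
        have hb : b = p • a + q • c := by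
          have : y • b = (-x) • a + (-z) • c := by
            have : y • b = (x • a + y • b + z • c) + ((-x) • a + (-z) • c) := by module
            rw [this, hrel, zero_add]
          rw [hp, hq, div_eq_inv_mul, div_eq_inv_mul, mul_smul, mul_smul, ← smul_add, ← this,
            smul_smul, inv_mul_cancel₀ hy0.ne', one_smul]
        rcases le_total (s * q) (t * p) with h | h
        · have h1 : 0 ≤ t - q * (s / p) := by
            rw [sub_nonneg, mul_div_assoc', div_le_iff₀ hp0]; linarith
          have := hbc.cone hC (x := s / p) (y := t - q * (s / p)) (by positivity) h1
          convert this using 1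
          rw [hb, smul_add, smul_smul, smul_smul, div_mul_cancel₀ _ hp0.ne', add_assoc, ← add_smul]
          congr 2; ring
        · have h1 : 0 ≤ s - p * (t / q) := by
            rw [sub_nonneg, mul_div_assoc', div_le_iff₀ hq0]; linarith
          have := hab.cone hC (x := s - p * (t / q)) (y := t / q) h1 (by positivity)
          convert this using 1
          rw [hb, smul_add, smul_smul, smul_smul, div_mul_cancel₀ _ hq0.ne', ← add_assoc,
            ← add_smul]
          congr 2; ring
  obtain ⟨x, y, z, hne, hrel⟩ := exists_rel a b c
  rcases le_total 0 y with hy | hy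
  · exact main x y z hne hrel hy
  · refine main (-x) (-y) (-z) (by simpa using hne) ?_ (by linarith)
    have : -(x • a + y • b + z • c) = 0 := by rw [hrel, neg_zero]
    rw [← this]; module

lemma theta {s t u x y z : ℝ} (hs : 0 ≤ s) (ht : 0 ≤ t) (hu : 0 ≤ u)
    (hpos : 0 < x ∨ 0 < y ∨ 0 < z) : ∃ θ : ℝ, 0 ≤ s - θ * x ∧ 0 ≤ t - θ * y ∧ 0 ≤ u - θ * z ∧
        (s - θ * x = 0 ∨ t - θ * y = 0 ∨ u - θ * z = 0) := by
  let X : Fin 3 → ℝ := ![x, y, z]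
  let S : Fin 3 → ℝ := ![s, t, u]
  have hS : ∀ i, 0 ≤ S i := by
    intro i; fin_cases i <;> simpa [S]
  have hne : (Finset.univ.filter (fun i => 0 < X i)).Nonempty := by
    rcases hpos with h | h | h
    · exact ⟨0, by simpa [X] using h⟩
    · exact ⟨1, by simpa [X] using h⟩
    · exact ⟨2, by simpa [X] using h⟩
  obtain ⟨i, hi, hmin⟩ := Finset.exists_min_image _ (fun i => S i / X i) hne
  have hi' : 0 < X i := by simpa using hi
  have hθ : 0 ≤ S i / X i := div_nonneg (hS i) hi'.le
  have hj : ∀ j, 0 ≤ S j - (S i / X i) * X j := by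
    intro j
    rcases le_or_gt (X j) 0 with h | h
    · have := hS j
      nlinarith
    · have := hmin j (by simpa using h)
      rw [le_div_iff₀ h] at this
      linarith
  have he : S i - (S i / X i) * X i = 0 := by
    rw [div_mul_cancel₀ _ hi'.ne', sub_self]
  refine ⟨S i / X i, hj 0, hj 1, hj 2, ?_⟩
  generalize S i / X i = θ at he
  fin_cases i
  · exact Or.inl he
  · exact Or.inr (Or.inl he)
  · exact Or.inr (Or.inr he)

/-- three pairwise visible points span a cone in C -/
lemma cone3 {C : Set E2} (hC : IsCone C) {a b c : E2} (hab : Vis C a b) (hbc : Vis C b c)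
    (hac : Vis C a c) {s t u : ℝ} (hs : 0 ≤ s) (ht : 0 ≤ t) (hu : 0 ≤ u) :
    s • a + t • b + u • c ∈ C := by
  -- if a is a nonneg combination etc.
  have main : ∀ x y z : ℝ, x • a + y • b + z • c = 0 → (0 < x ∨ 0 < y ∨ 0 < z) →
      s • a + t • b + u • c ∈ C := by
    intro x y z hrel hpos
    -- choose θ
    have key : ∃ θ : ℝ, 0 ≤ s - θ * x ∧ 0 ≤ t - θ * y ∧ 0 ≤ u - θ * z ∧
        (s - θ * x = 0 ∨ t - θ * y = 0 ∨ u - θ * z = 0) := by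
      exact theta hs ht hu hpos
    obtain ⟨θ, h1, h2, h3, h4⟩ := key
    have e : s • a + t • b + u • c = (s - θ * x) • a + (t - θ * y) • b + (u - θ * z) • c := by
      have : s • a + t • b + u • c = (s - θ * x) • a + (t - θ * y) • b + (u - θ * z) • c
        + θ • (x • a + y • b + z • c) := by module
      rw [this, hrel]; simp
    rw [e]
    rcases h4 with h | h | h
    · rw [h, zero_smul, zero_add]; exact hbc.cone hC h2 h3
    · rw [h, zero_smul, add_zero]; exact hac.cone hC h1 h3
    · rw [h, zero_smul, add_zero]; exact hab.cone hC h1 h2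
  obtain ⟨x, y, z, hne, hrel⟩ := exists_rel a b c
  by_cases hp : 0 < x ∨ 0 < y ∨ 0 < z
  · exact main x y z hrel hp
  · refine main (-x) (-y) (-z) ?_ ?_
    · have : -(x • a + y • b + z • c) = 0 := by rw [hrel, neg_zero]
      rw [← this]; module
    · push Not at hp
      obtain ⟨p, q, r⟩ := hp
      rcases hne with h | h | h
      · exact Or.inl (by have := lt_of_le_of_ne p h; linarith)
      · exact Or.inr (Or.inl (by have := lt_of_le_of_ne q h; linarith))
      · exact Or.inr (Or.inr (by have := lt_of_le_of_ne r h; linarith))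


end

section

open Classical in
/-- intrinsic distance of a planar cone -/
def cd (C : Set E2) (a b : E2) : ℝ := if Vis C a b then ‖a - b‖ else ‖a‖ + ‖b‖

lemma cd_vis {C : Set E2} {a b : E2} (h : Vis C a b) : cd C a b = ‖a - b‖ := by
  simp [cd, h]

lemma cd_not {C : Set E2} {a b : E2} (h : ¬ Vis C a b) : cd C a b = ‖a‖ + ‖b‖ := by
  simp [cd, h]

lemma cd_le (C : Set E2) (a b : E2) : cd C a b ≤ ‖a‖ + ‖b‖ := by
  by_cases h : Vis C a b
  · rw [cd_vis h]; exact norm_sub_le a b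
  · rw [cd_not h]

lemma le_cd (C : Set E2) (a b : E2) : ‖a - b‖ ≤ cd C a b := by
  by_cases h : Vis C a b
  · rw [cd_vis h]
  · rw [cd_not h]; exact norm_sub_le a b

lemma cd_nonneg (C : Set E2) (a b : E2) : 0 ≤ cd C a b := (norm_nonneg _).trans (le_cd C a b)

lemma cd_symm (C : Set E2) (a b : E2) : cd C a b = cd C b a := by
  by_cases h : Vis C a b
  · rw [cd_vis h, cd_vis h.symm, norm_sub_rev]
  · rw [cd_not h, cd_not (fun h' => h h'.symm), add_comm]

lemma ne_of_not_vis {C : Set E2} (hC : IsCone C) {a b : E2} (ha : a ∈ C) (hb : b ∈ C)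
    (h : ¬ Vis C a b) : 0 < ‖a‖ ∧ 0 < ‖b‖ := by
  constructor
  · rw [norm_pos_iff]; rintro rfl; exact h (vis_zero hC hb).symm
  · rw [norm_pos_iff]; rintro rfl; exact h (vis_zero hC ha)

lemma sub_norm_ge (a b : E2) : ‖a‖ ^ 2 - inner ℝ b a ≤ ‖a - b‖ * ‖a‖ := by
  have h := real_inner_le_norm (a - b) a
  rw [inner_sub_left, real_inner_self_eq_norm_sq] at h
  exact h

lemma cd_triangle {C : Set E2} (hC : IsCone C) {a b c : E2} (ha : a ∈ C) (hc : c ∈ C) :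
    cd C a c ≤ cd C a b + cd C b c := by
  by_cases hac : Vis C a c
  · rw [cd_vis hac]
    calc ‖a - c‖ ≤ ‖a - b‖ + ‖b - c‖ := norm_sub_le_norm_sub_add_norm_sub a b c
      _ ≤ _ := add_le_add (le_cd _ _ _) (le_cd _ _ _)
  obtain ⟨hna, hnc⟩ := ne_of_not_vis hC ha hc hac
  have h1 : ‖a‖ ≤ ‖a - b‖ + ‖b‖ := by
    have := norm_add_le (a - b) b; simpa using this
  have h2 : ‖c‖ ≤ ‖b - c‖ + ‖b‖ := by
    have := norm_add_le (c - b) b; rw [norm_sub_rev b c]; simpa using this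
  have h3 := norm_nonneg b
  rw [cd_not hac]
  by_cases hab : Vis C a b <;> by_cases hbc : Vis C b c
  · rw [cd_vis hab, cd_vis hbc]
    have hk := key_angle hC hab hbc hac
    have e1 := mul_le_mul_of_nonneg_left (sub_norm_ge a b) hnc.le
    have e2 := mul_le_mul_of_nonneg_left (sub_norm_ge c b) hna.le
    rw [norm_sub_rev c b] at e2
    have : (‖a‖ * ‖c‖) * (‖a‖ + ‖c‖) ≤ (‖a‖ * ‖c‖) * (‖a - b‖ + ‖b - c‖) := by
      nlinarith
    exact le_of_mul_le_mul_left this (by positivity)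
  · rw [cd_vis hab, cd_not hbc]; linarith
  · rw [cd_not hab, cd_vis hbc]; linarith
  · rw [cd_not hab, cd_not hbc]; linarith

/-- explicit midpoints -/
def IsM (C : Set E2) (a b m : E2) : Prop :=
  (Vis C a b ∧ m = (1 / 2 : ℝ) • a + (1 / 2 : ℝ) • b) ∨
  (¬ Vis C a b ∧ ∃ l : ℝ, 0 ≤ l ∧ m = l • a ∧ l * ‖a‖ = (‖a‖ - ‖b‖) / 2) ∨
  (¬ Vis C a b ∧ ∃ l : ℝ, 0 ≤ l ∧ m = l • b ∧ l * ‖b‖ = (‖b‖ - ‖a‖) / 2)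

lemma IsM.symm {C : Set E2} {a b m : E2} (h : IsM C a b m) : IsM C b a m := by
  rcases h with ⟨h, e⟩ | ⟨h, r⟩ | ⟨h, r⟩
  · exact Or.inl ⟨h.symm, by rw [e, add_comm]⟩
  · exact Or.inr (Or.inr ⟨fun h' => h h'.symm, r⟩)
  · exact Or.inr (Or.inl ⟨fun h' => h h'.symm, r⟩)

lemma IsM.mem {C : Set E2} (hC : IsCone C) {a b m : E2} (ha : a ∈ C) (hb : b ∈ C)
    (h : IsM C a b m) : m ∈ C := by
  rcases h with ⟨h, rfl⟩ | ⟨h, l, hl, rfl, _⟩ | ⟨h, l, hl, rfl, _⟩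
  · exact h.cone hC (by norm_num) (by norm_num)
  · exact hC a ha l hl
  · exact hC b hb l hl

lemma exists_isM {C : Set E2} (hC : IsCone C) {a b : E2} (ha : a ∈ C) (hb : b ∈ C) :
    ∃ m, IsM C a b m := by
  by_cases h : Vis C a b
  · exact ⟨_, Or.inl ⟨h, rfl⟩⟩
  obtain ⟨hna, hnb⟩ := ne_of_not_vis hC ha hb h
  rcases le_total ‖b‖ ‖a‖ with hle | hle
  · refine ⟨_, Or.inr (Or.inl ⟨h, (‖a‖ - ‖b‖) / 2 / ‖a‖, ?_, rfl, ?_⟩)⟩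
    · have : 0 ≤ ‖a‖ - ‖b‖ := by linarith
      positivity
    · field_simp
  · refine ⟨_, Or.inr (Or.inr ⟨h, (‖b‖ - ‖a‖) / 2 / ‖b‖, ?_, rfl, ?_⟩)⟩
    · have : 0 ≤ ‖b‖ - ‖a‖ := by linarith
      positivity
    · field_simp

lemma IsM.cd_left {C : Set E2} (hC : IsCone C) {a b m : E2} (ha : a ∈ C)
    (h : IsM C a b m) : cd C a m ≤ cd C a b / 2 := by
  rcases h with ⟨h, rfl⟩ | ⟨h, l, hl, rfl, e⟩ | ⟨h, l, hl, rfl, e⟩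
  · have hv := h.sub hC (x := 1) (y := 0) (z := 1 / 2) (w := 1 / 2) (by norm_num) (by norm_num)
      (by norm_num) (by norm_num)
    have e1 : (1:ℝ) • a + (0:ℝ) • b = a := by simp
    rw [e1] at hv
    rw [cd_vis hv, cd_vis h]
    have : a - ((1 / 2 : ℝ) • a + (1 / 2 : ℝ) • b) = (1 / 2 : ℝ) • (a - b) := by module
    rw [this, norm_smul]; norm_num; linarith
  · have hv := vis_ray hC ha (x := 1) (y := l) (by norm_num) hl
    rw [one_smul] at hv
    rw [cd_vis hv, cd_not h]
    have hb := norm_nonneg b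
    rcases le_or_gt l 1 with h1 | h1
    · have : a - l • a = (1 - l) • a := by module
      rw [this, norm_smul, Real.norm_eq_abs, abs_of_nonneg (by linarith)]
      linarith
    · have := norm_nonneg a
      have h2 := norm_sub_le a (l • a)
      rw [norm_smul, Real.norm_eq_abs, abs_of_nonneg hl] at h2
      nlinarith
  · refine (cd_le _ _ _).trans ?_
    rw [cd_not h, norm_smul, Real.norm_eq_abs, abs_of_nonneg hl]
    linarith

lemma IsM.cd_right {C : Set E2} (hC : IsCone C) {a b m : E2} (hb : b ∈ C)
    (h : IsM C a b m) : cd C m b ≤ cd C a b / 2 := by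
  rw [cd_symm C m b, cd_symm C a b]
  exact h.symm.cd_left hC hb

lemma norm_half_comb (a b : E2) : ‖(1 / 2 : ℝ) • a + (1 / 2 : ℝ) • b‖ = ‖a + b‖ / 2 := by
  rw [← smul_add, norm_smul]; norm_num; ring

/-- collinearity from equality in Cauchy–Schwarz -/
lemma parallel_of {a m : E2} (ha : 0 < ‖a‖) (h : ‖a - m‖ * ‖a‖ ≤ ‖a‖ ^ 2 - inner ℝ m a) :
    ∃ t : ℝ, m = t • a := by
  have h' : inner ℝ (a - m) a = ‖a - m‖ * ‖a‖ := by
    apply le_antisymm (real_inner_le_norm _ _)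
    rw [inner_sub_left, real_inner_self_eq_norm_sq]; exact h
  rw [inner_eq_norm_mul_iff_real] at h'
  refine ⟨1 - ‖a - m‖ / ‖a‖, ?_⟩
  have h2 : a - m = (‖a - m‖ / ‖a‖) • a := by
    rw [div_eq_inv_mul, mul_smul, ← h', smul_smul, inv_mul_cancel₀ ha.ne', one_smul]
  rw [sub_smul, one_smul, ← h2]; abel

lemma vis_of_parallel {C : Set E2} (hC : IsCone C) {a b : E2} (ha : a ∈ C) (hb : b ∈ C) {k : ℝ}
    (h : a = k • b) : Vis C a b := by
  rcases le_or_gt 0 k with hk | hk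
  · have := vis_ray hC hb (x := k) (y := 1) hk zero_le_one
    rw [← h, one_smul] at this; exact this
  · rw [vis_iff]
    intro s t hs ht _
    rcases le_total 0 (s * k + t) with h0 | h0
    · have := hC b hb _ h0
      convert this using 1
      rw [h]; module
    · have := hC a ha ((s * k + t) / k) (div_nonneg_of_nonpos h0 hk.le)
      convert this using 1
      rw [h, smul_smul ((s * k + t) / k), div_mul_cancel₀ _ hk.ne]; module

lemma isM_aux {C : Set E2} {a b m : E2} (hab : ¬ Vis C a b)
    (hna : 0 < ‖a‖) (hm : Vis C a m) (hmb : ¬ Vis C m b)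
    (h1 : cd C a m ≤ cd C a b / 2) (h2 : cd C m b ≤ cd C a b / 2) : IsM C a b m := by
  rw [cd_not hab] at h1 h2
  rw [cd_vis hm] at h1
  rw [cd_not hmb] at h2
  have h3 : ‖a‖ ≤ ‖a - m‖ + ‖m‖ := by
    have := norm_add_le (a - m) m; simpa using this
  have h4 : ‖m‖ = (‖a‖ - ‖b‖) / 2 := by linarith
  have h5 : ‖a - m‖ = ‖a‖ - ‖m‖ := by linarith
  have h6 : inner ℝ m a = ‖m‖ * ‖a‖ := by
    have := norm_sub_sq_real a m
    rw [h5, real_inner_comm] at this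
    nlinarith
  obtain ⟨t, ht⟩ := parallel_of (a := a) (m := m) hna (by rw [h6, h5]; nlinarith)
  refine Or.inr (Or.inl ⟨hab, ‖m‖ / ‖a‖, by positivity, ?_, by rw [div_mul_cancel₀ _ hna.ne', h4]⟩)
  rw [inner_eq_norm_mul_iff_real] at h6
  rw [div_eq_inv_mul, mul_smul, ← h6, smul_smul, inv_mul_cancel₀ hna.ne', one_smul]

lemma isM_of {C : Set E2} (hC : IsCone C) {a b m : E2} (ha : a ∈ C) (hb : b ∈ C)
    (h1 : cd C a m ≤ cd C a b / 2) (h2 : cd C m b ≤ cd C a b / 2) : IsM C a b m := by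
  by_cases hab : Vis C a b
  · left
    refine ⟨hab, ?_⟩
    rw [cd_vis hab] at h1 h2
    have e1 := (le_cd C a m).trans h1
    have e2 := (le_cd C m b).trans h2
    have e3 := norm_sub_le_norm_sub_add_norm_sub a m b
    have := eq_midpoint_of_dist_eq_half (x := a) (y := m) (z := b)
      (by rw [dist_eq_norm, dist_eq_norm]; linarith) (by rw [dist_eq_norm, dist_eq_norm]; linarith)
    rw [this, midpoint_eq_smul_add, smul_add]; norm_num
  obtain ⟨hna, hnb⟩ := ne_of_not_vis hC ha hb hab
  by_cases ham : Vis C a m <;> by_cases hmb : Vis C m b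
  · -- m = 0
    have hm0 : m = 0 := by
      by_contra hm0
      have hk := key_angle hC ham hmb hab
      rw [cd_not hab, cd_vis ham] at h1
      rw [cd_not hab, cd_vis hmb] at h2
      have e1 := mul_le_mul_of_nonneg_left (sub_norm_ge a m) hnb.le
      have e2 := mul_le_mul_of_nonneg_left (sub_norm_ge b m) hna.le
      rw [norm_sub_rev b m] at e2
      have e3 : (‖a‖ * ‖b‖) * (‖a - m‖ + ‖m - b‖) ≤ (‖a‖ * ‖b‖) * (‖a‖ + ‖b‖) :=
        mul_le_mul_of_nonneg_left (by linarith) (by positivity)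
      have e4 : ‖b‖ * (‖a - m‖ * ‖a‖) ≤ ‖b‖ * (‖a‖ ^ 2 - inner ℝ m a) := by nlinarith
      have e5 : ‖a‖ * (‖m - b‖ * ‖b‖) ≤ ‖a‖ * (‖b‖ ^ 2 - inner ℝ m b) := by nlinarith
      obtain ⟨t, ht⟩ := parallel_of hna (le_of_mul_le_mul_left e4 hnb)
      rw [norm_sub_rev m b] at e5
      obtain ⟨t', ht'⟩ := parallel_of hnb (le_of_mul_le_mul_left e5 hna)
      have ht0 : t ≠ 0 := by rintro rfl; exact hm0 (by simpa using ht)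
      apply hab
      refine vis_of_parallel hC ha hb (k := t' / t) ?_
      rw [div_eq_inv_mul, mul_smul, ← ht', ht, smul_smul, inv_mul_cancel₀ ht0, one_smul]
    subst hm0
    rw [cd_not hab, cd_vis ham, sub_zero] at h1
    rw [cd_not hab, cd_vis hmb, zero_sub, norm_neg] at h2
    refine Or.inr (Or.inl ⟨hab, 0, le_rfl, by simp, ?_⟩)
    linarith
  · exact isM_aux hab hna ham hmb h1 h2
  · apply IsM.symm
    rw [cd_symm C a m, cd_symm C a b] at h1
    rw [cd_symm C m b, cd_symm C a b] at h2
    exact isM_aux (fun h => hab h.symm) hnb hmb.symm (fun h => ham h.symm) h2 h1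
  · exfalso
    rw [cd_not hab, cd_not ham] at h1
    rw [cd_not hab, cd_not hmb] at h2
    have : m = 0 := by
      have := norm_nonneg m
      rw [← norm_eq_zero]; linarith
    subst this
    exact ham (vis_zero hC ha)


end

section

lemma norm_le_of_sq {u v : E2} (h : ‖u‖ ^ 2 ≤ ‖v‖ ^ 2) : ‖u‖ ≤ ‖v‖ :=
  le_of_sq_le_sq h (norm_nonneg _)

lemma inner_ge (a c : E2) : -(‖a‖ * ‖c‖) ≤ inner ℝ a c :=
  neg_le_of_abs_le (abs_real_inner_le_norm a c)

/-- case: `ab`, `bc` visible, `ac` not visible -/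
lemma bus_TFT {C : Set E2} (hC : IsCone C) {a b c m m' : E2} (ha : a ∈ C)
    (hc : c ∈ C) (hab : Vis C a b) (hbc : Vis C b c) (hac : ¬ Vis C a c)
    (hm : IsM C a b m) (hm' : IsM C a c m') : cd C m m' ≤ cd C b c / 2 := by
  obtain ⟨hna, hnc⟩ := ne_of_not_vis hC ha hc hac
  have hk := key_angle hC hab hbc hac
  have hmm : m = (1 / 2 : ℝ) • a + (1 / 2 : ℝ) • b := by
    rcases hm with ⟨_, e⟩ | ⟨h, _⟩ | ⟨h, _⟩
    · exact e
    · exact absurd hab h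
    · exact absurd hab h
  rw [cd_vis hbc]
  rcases hm' with ⟨h, _⟩ | ⟨_, l, hl, e, hlen⟩ | ⟨_, l, hl, e, hlen⟩
  · exact absurd h hac
  · have hv : Vis C m m' := by
      have := hab.sub hC (x := 1 / 2) (y := 1 / 2) (z := l) (w := 0) (by norm_num) (by norm_num)
        hl le_rfl
      rw [hmm, e]; simpa using this
    rw [cd_vis hv]
    have e2 : m - m' = (1 / 2 : ℝ) • (b + (‖c‖ / ‖a‖) • a) := by
      have hl' : l = 1 / 2 - ‖c‖ / ‖a‖ / 2 := by field_simp; linarith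
      rw [hmm, e, hl']; module
    rw [e2, norm_smul]
    have : ‖b + (‖c‖ / ‖a‖) • a‖ ≤ ‖b - c‖ := by
      apply norm_le_of_sq
      rw [norm_add_sq_real, norm_sub_sq_real, norm_smul, inner_smul_right, Real.norm_eq_abs,
        abs_of_nonneg (by positivity), div_mul_cancel₀ _ hna.ne']
      have : ‖c‖ / ‖a‖ * inner ℝ b a ≤ - inner ℝ b c := by
        rw [div_mul_eq_mul_div, div_le_iff₀ hna]; linarith
      linarith
    norm_num; linarith
  · have hbm' : Vis C b m' := by
      have := hbc.sub hC (x := 1) (y := 0) (z := 0) (w := l) (by norm_num) le_rfl le_rfl hl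
      rw [e]; simpa using this
    have hmb : Vis C m b := by
      have := hab.sub hC (x := 1 / 2) (y := 1 / 2) (z := 0) (w := 1) (by norm_num) (by norm_num)
        le_rfl (by norm_num)
      rw [hmm]; simpa using this
    by_cases hv : Vis C m m'
    · rw [cd_vis hv]
      set r := ‖a‖ / ‖c‖ with hr
      have hr1 : r * ‖c‖ = ‖a‖ := div_mul_cancel₀ _ hnc.ne'
      have hr0 : 0 ≤ r := by positivity
      have hl' : l = 1 / 2 - r / 2 := by
        have : l * ‖c‖ = (1 / 2 - r / 2) * ‖c‖ := by rw [hlen]; linarith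
        exact mul_right_cancel₀ hnc.ne' this
      have e2 : m - m' = (1 / 2 : ℝ) • ((b - c) + (a + r • c)) := by
        rw [hmm, e, hl']; module
      rw [e2, norm_smul]
      have : ‖(b - c) + (a + r • c)‖ ≤ ‖b - c‖ := by
        apply norm_le_of_sq
        rw [norm_add_sq_real (b - c)]
        have n1 : ‖a + r • c‖ ^ 2 = ‖a‖ ^ 2 + 2 * (r * inner ℝ a c) + (r * ‖c‖) ^ 2 := by
          rw [norm_add_sq_real, inner_smul_right, norm_smul, Real.norm_eq_abs, abs_of_nonneg hr0]
        have n2 : inner ℝ (b - c) (a + r • c) =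
            inner ℝ b a + r * inner ℝ b c - inner ℝ a c - r * ‖c‖ ^ 2 := by
          rw [inner_sub_left, inner_add_right, inner_add_right, inner_smul_right,
            inner_smul_right, real_inner_self_eq_norm_sq, real_inner_comm a c]; ring
        have n3 : inner ℝ b a + r * inner ℝ b c ≤ 0 := by
          have : ‖c‖ * (inner ℝ b a + r * inner ℝ b c) ≤ 0 := by
            rw [mul_add, ← mul_assoc, mul_comm ‖c‖ r, hr1]; exact hk
          by_contra hcon
          push Not at hcon
          have := mul_pos hnc hcon
          linarith
        have n4 := inner_ge a c
        have n5 : 0 ≤ (1 - r) * (inner ℝ a c + ‖a‖ * ‖c‖) :=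
          mul_nonneg (by linarith) (by linarith)
        rw [n1, n2, ← hr1]
        rw [← hr1] at n5
        nlinarith
      norm_num; linarith
    · have hmC : m ∈ C := hmb (left_mem_segment ℝ _ _)
      have hm'C : m' ∈ C := hbm' (right_mem_segment ℝ _ _)
      obtain ⟨pm, pm'⟩ := ne_of_not_vis hC hmC hm'C hv
      rw [cd_not hv]
      have hk2 := key_angle hC hmb hbm' hv
      have nm' : ‖m'‖ = l * ‖c‖ := by rw [e, norm_smul, Real.norm_eq_abs, abs_of_nonneg hl]
      have hl0 : 0 < l := by
        rcases hl.eq_or_lt with h | h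
        · rw [← h] at nm'; linarith
        · exact h
      have hk3 : ‖c‖ * inner ℝ b m + ‖m‖ * inner ℝ b c ≤ 0 := by
        rw [nm', e, inner_smul_right] at hk2
        by_contra hcon
        push Not at hcon
        have := mul_pos hl0 hcon
        linarith
      -- ‖b - c‖ ≥ ‖c‖ - ⟨b, c⟩/‖c‖
      have g1 : ‖c‖ ^ 2 - inner ℝ b c ≤ ‖b - c‖ * ‖c‖ := by
        have := sub_norm_ge c b; rwa [norm_sub_rev] at this
      have g2 : ‖m‖ * ‖c‖ ^ 2 + ‖c‖ * inner ℝ b m ≤ ‖m‖ * (‖b - c‖ * ‖c‖) := by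
        have := mul_le_mul_of_nonneg_left g1 pm.le
        linarith
      have g3 : ‖m‖ * ‖c‖ + inner ℝ b m ≤ ‖m‖ * ‖b - c‖ := by
        have : ‖c‖ * (‖m‖ * ‖c‖ + inner ℝ b m) ≤ ‖c‖ * (‖m‖ * ‖b - c‖) := by linarith
        exact le_of_mul_le_mul_left this hnc
      have g4 : 2 * ‖m‖ ^ 2 = inner ℝ a m + inner ℝ b m := by
        rw [← inner_add_left, ← real_inner_self_eq_norm_sq]
        have : a + b = (2:ℝ) • m := by rw [hmm]; module
        rw [this, inner_smul_left]; simp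
      have g5 := real_inner_le_norm a m
      have : ‖m‖ * (‖m‖ + ‖m'‖) ≤ ‖m‖ * (‖b - c‖ / 2) := by
        rw [nm', hlen]; nlinarith
      exact le_of_mul_le_mul_left this pm

/-- case: `ab` visible, `ac`, `bc` not -/
lemma bus_TFF {C : Set E2} (hC : IsCone C) {a b c m m' : E2} (ha : a ∈ C) (hb : b ∈ C)
    (hc : c ∈ C) (hab : Vis C a b) (hbc : ¬ Vis C b c) (hac : ¬ Vis C a c)
    (hm : IsM C a b m) (hm' : IsM C a c m') : cd C m m' ≤ cd C b c / 2 := by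
  have hmC := hm.mem hC ha hb
  have hm'C := hm'.mem hC ha hc
  have hmm : m = (1 / 2 : ℝ) • a + (1 / 2 : ℝ) • b := by
    rcases hm with ⟨_, e⟩ | ⟨h, _⟩ | ⟨h, _⟩
    · exact e
    · exact absurd hab h
    · exact absurd hab h
  have h1 : cd C m ((1 / 2 : ℝ) • a) ≤ ‖b‖ / 2 := by
    have hv : Vis C m ((1 / 2 : ℝ) • a) := by
      have := hab.sub hC (x := 1 / 2) (y := 1 / 2) (z := 1 / 2) (w := 0) (by norm_num)
        (by norm_num) (by norm_num) le_rfl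
      rw [hmm]; simpa using this
    rw [cd_vis hv, hmm, add_sub_cancel_left, norm_smul]; norm_num; linarith
  have h2 : cd C ((1 / 2 : ℝ) • a) m' ≤ ‖c‖ / 2 := by
    rcases hm' with ⟨h, _⟩ | ⟨_, l, hl, e, hlen⟩ | ⟨_, l, hl, e, hlen⟩
    · exact absurd h hac
    · rw [e, cd_vis (vis_ray hC ha (by norm_num) hl), ← sub_smul, norm_smul, Real.norm_eq_abs]
      rw [← abs_of_nonneg (norm_nonneg a), ← abs_mul, sub_mul, hlen]
      rw [abs_le]
      have := norm_nonneg c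
      constructor <;> linarith
    · refine (cd_le _ _ _).trans ?_
      rw [e, norm_smul, norm_smul, Real.norm_eq_abs, Real.norm_eq_abs, abs_of_nonneg hl, hlen]
      norm_num; linarith
  rw [cd_not hbc]
  have := cd_triangle hC (b := (1 / 2 : ℝ) • a) hmC hm'C
  linarith

lemma smul_norm_nonneg {l : ℝ} (hl : 0 ≤ l) (a : E2) : ‖l • a‖ = l * ‖a‖ := by
  rw [norm_smul, Real.norm_eq_abs, abs_of_nonneg hl]

/-- case: `ab`, `ac` not visible -/
lemma bus_FF {C : Set E2} (hC : IsCone C) {a b c m m' : E2} (ha : a ∈ C) (hb : b ∈ C)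
    (hc : c ∈ C) (hab : ¬ Vis C a b) (hac : ¬ Vis C a c)
    (hm : IsM C a b m) (hm' : IsM C a c m') : cd C m m' ≤ cd C b c / 2 := by
  obtain ⟨hna, hnc⟩ := ne_of_not_vis hC ha hc hac
  obtain ⟨_, hnb⟩ := ne_of_not_vis hC ha hb hab
  have n1 := le_cd C b c
  have n2 := abs_norm_sub_norm_le b c
  have n3 := abs_le.1 (n2.trans n1)
  rcases hm with ⟨h, _⟩ | ⟨_, l, hl, e, hlen⟩ | ⟨_, l, hl, e, hlen⟩
  · exact absurd h hab
  · rcases hm' with ⟨h, _⟩ | ⟨_, l', hl', e', hlen'⟩ | ⟨_, l', hl', e', hlen'⟩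
    · exact absurd h hac
    · rw [e, e', cd_vis (vis_ray hC ha hl hl'), ← sub_smul, norm_smul, Real.norm_eq_abs]
      rw [← abs_of_nonneg (norm_nonneg a), ← abs_mul, sub_mul, hlen,
        hlen', abs_le]
      constructor <;> linarith
    · refine (cd_le _ _ _).trans ?_
      rw [e, e', smul_norm_nonneg hl, smul_norm_nonneg hl', hlen, hlen']
      linarith
  · rcases hm' with ⟨h, _⟩ | ⟨_, l', hl', e', hlen'⟩ | ⟨_, l', hl', e', hlen'⟩
    · exact absurd h hac
    · refine (cd_le _ _ _).trans ?_
      rw [e, e', smul_norm_nonneg hl, smul_norm_nonneg hl', hlen, hlen']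
      linarith
    · by_cases hbc : Vis C b c
      · have hv : Vis C m m' := by
          have := hbc.sub hC (x := l) (y := 0) (z := 0) (w := l') hl le_rfl le_rfl hl'
          rw [e, e']; simpa using this
        rw [cd_vis hv, cd_vis hbc]
        have k1 : ‖m - m'‖ ^ 2 ≤ (‖b - c‖ / 2) ^ 2 := by
          rw [e, e', norm_sub_sq_real, smul_norm_nonneg hl, smul_norm_nonneg hl', hlen, hlen',
            inner_smul_left, inner_smul_right, div_pow ‖b - c‖, norm_sub_sq_real]
          simp only [RCLike.conj_to_real]
          have k2 : l = (1 - ‖a‖ / ‖b‖) / 2 := by field_simp; linarith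
          have k3 : l' = (1 - ‖a‖ / ‖c‖) / 2 := by field_simp; linarith
          have k5 := real_inner_le_norm b c
          -- ‖b‖‖c‖ (1/4 - l l') ≥ ...
          have lb : l ≤ 1 / 2 := by
            have : 0 ≤ ‖a‖ / ‖b‖ := by positivity
            linarith
          have lc : l' ≤ 1 / 2 := by
            have : 0 ≤ ‖a‖ / ‖c‖ := by positivity
            linarith
          have k6 : 0 ≤ (1 / 4 - l * l') * (‖b‖ * ‖c‖ - inner ℝ b c) :=
            mul_nonneg (by nlinarith) (by linarith)
          have k7 : l * l' * (‖b‖ * ‖c‖) = (‖b‖ - ‖a‖) / 2 * ((‖c‖ - ‖a‖) / 2) := by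
            rw [← hlen, ← hlen']; ring
          nlinarith
        exact le_of_sq_le_sq k1 (by positivity)
      · rw [cd_not hbc]
        refine (cd_le _ _ _).trans ?_
        rw [e, e', smul_norm_nonneg hl, smul_norm_nonneg hl', hlen, hlen']
        linarith

lemma bus_TT {C : Set E2} (hC : IsCone C) {a b c m m' : E2} (ha : a ∈ C) (hb : b ∈ C)
    (hc : c ∈ C) (hab : Vis C a b) (hac : Vis C a c)
    (hm : IsM C a b m) (hm' : IsM C a c m') : cd C m m' ≤ cd C b c / 2 := by
  have hmC := hm.mem hC ha hb
  have hm'C := hm'.mem hC ha hc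
  have hmm : m = (1 / 2 : ℝ) • a + (1 / 2 : ℝ) • b := by
    rcases hm with ⟨_, e⟩ | ⟨h, _⟩ | ⟨h, _⟩
    · exact e
    · exact absurd hab h
    · exact absurd hab h
  have hmm' : m' = (1 / 2 : ℝ) • a + (1 / 2 : ℝ) • c := by
    rcases hm' with ⟨_, e⟩ | ⟨h, _⟩ | ⟨h, _⟩
    · exact e
    · exact absurd hac h
    · exact absurd hac h
  by_cases hbc : Vis C b c
  · have hv : Vis C m m' := by
      rw [vis_iff]
      intro s t hs ht hst
      have := cone3 hC hab hbc hac (s := (s + t) / 2) (t := s / 2) (u := t / 2) (by positivity)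
        (by positivity) (by positivity)
      rw [hmm, hmm']
      convert this using 1
      module
    rw [cd_vis hv, cd_vis hbc]
    have : m - m' = (1 / 2 : ℝ) • (b - c) := by rw [hmm, hmm']; module
    rw [this, norm_smul]; norm_num; linarith
  · have h1 : ∀ {b m : E2}, Vis C a b → m = (1 / 2 : ℝ) • a + (1 / 2 : ℝ) • b →
        cd C m ((1 / 2 : ℝ) • a) ≤ ‖b‖ / 2 := by
      intro b m hab hmm
      have hv : Vis C m ((1 / 2 : ℝ) • a) := by
        have := hab.sub hC (x := 1 / 2) (y := 1 / 2) (z := 1 / 2) (w := 0) (by norm_num)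
          (by norm_num) (by norm_num) le_rfl
        rw [hmm]; simpa using this
      rw [cd_vis hv, hmm, add_sub_cancel_left, norm_smul]; norm_num; linarith
    have e1 := h1 hab hmm
    have e2 := h1 hac hmm'
    rw [cd_symm] at e2
    rw [cd_not hbc]
    have := cd_triangle hC (b := (1 / 2 : ℝ) • a) hmC hm'C
    linarith

lemma bus3 {C : Set E2} (hC : IsCone C) {a b c m m' : E2} (ha : a ∈ C) (hb : b ∈ C)
    (hc : c ∈ C) (hm : IsM C a b m) (hm' : IsM C a c m') : cd C m m' ≤ cd C b c / 2 := by
  by_cases hab : Vis C a b <;> by_cases hac : Vis C a c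
  · exact bus_TT hC ha hb hc hab hac hm hm'
  · by_cases hbc : Vis C b c
    · exact bus_TFT hC ha hc hab hbc hac hm hm'
    · exact bus_TFF hC ha hb hc hab hbc hac hm hm'
  · rw [cd_symm C m m', cd_symm C b c]
    by_cases hbc : Vis C b c
    · exact bus_TFT hC ha hb hac hbc.symm hab hm' hm
    · exact bus_TFF hC ha hc hb hac (fun h => hbc h.symm) hab hm' hm
  · exact bus_FF hC ha hb hc hab hac hm hm'

/-- Busemann convexity in planar cones -/
lemma bus4 {C : Set E2} (hC : IsCone C) {a b m a' b' m' : E2} (ha : a ∈ C) (hb : b ∈ C)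
    (ha' : a' ∈ C) (hb' : b' ∈ C) (hm : IsM C a b m) (hm' : IsM C a' b' m') :
    cd C m m' ≤ (cd C a a' + cd C b b') / 2 := by
  obtain ⟨n, hn⟩ := exists_isM hC ha hb'
  have h1 := bus3 hC ha hb hb' hm hn
  have h2 := bus3 hC hb' ha ha' hn.symm hm'.symm
  have := cd_triangle hC (b := n) (hm.mem hC ha hb) (hm'.mem hC ha' hb')
  linarith


end

section

lemma ray_exit (F : Finset E2) {p x : E2} (hp : p ∈ convexHull ℝ (F : Set E2))
    (hx : x ∈ convexHull ℝ (F : Set E2)) (hne : x ≠ p) :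
    ∃ f ∈ F, ∃ τ : ℝ, 1 ≤ τ ∧ p + τ • (x - p) ∈ convexHull ℝ ((F.erase f : Finset E2) : Set E2) := by
  rw [Finset.mem_convexHull'] at hp hx
  obtain ⟨l, hl0, hl1, hlp⟩ := hp
  obtain ⟨w, hw0, hw1, hwx⟩ := hx
  have hex : ∃ f ∈ F, w f < l f := by
    by_contra hcon
    push Not at hcon
    apply hne
    rw [← hlp, ← hwx]
    have := (Finset.sum_eq_sum_iff_of_le hcon).1 (by rw [hl1, hw1])
    exact Finset.sum_congr rfl fun f hf => by rw [this f hf]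
  obtain ⟨f, hf, hmin⟩ := Finset.exists_min_image (F.filter fun f => w f < l f)
    (fun f => l f / (l f - w f)) (by obtain ⟨f, hf, h⟩ := hex; exact ⟨f, by simp [hf, h]⟩)
  simp only [Finset.mem_filter] at hf hmin
  obtain ⟨hfF, hlt⟩ := hf
  have hpos : 0 < l f - w f := by linarith
  set τ := l f / (l f - w f) with hτ
  have hτ1 : 1 ≤ τ := by rw [hτ, le_div_iff₀ hpos]; linarith [hw0 f hfF]
  have hu0 : ∀ g ∈ F, 0 ≤ l g + τ * (w g - l g) := by
    intro g hg
    rcases lt_or_ge (w g) (l g) with h | h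
    · have := hmin g ⟨hg, h⟩
      have hp' : 0 < l g - w g := by linarith
      rw [le_div_iff₀ hp'] at this
      linarith
    · have := mul_nonneg (by linarith : 0 ≤ τ) (by linarith : 0 ≤ w g - l g)
      linarith [hl0 g hg]
  have huf : l f + τ * (w f - l f) = 0 := by
    rw [hτ]; field_simp; ring
  refine ⟨f, hfF, τ, hτ1, ?_⟩
  rw [Finset.mem_convexHull']
  refine ⟨fun g => l g + τ * (w g - l g), fun g hg => hu0 g (Finset.mem_of_mem_erase hg), ?_, ?_⟩
  · have h1 := Finset.sum_erase (s := F) (f := fun g => l g + τ * (w g - l g)) (a := f) huf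
    rw [h1, Finset.sum_add_distrib, ← Finset.mul_sum, Finset.sum_sub_distrib, hl1, hw1]; ring
  · have h1 := Finset.sum_erase (s := F) (f := fun g => (l g + τ * (w g - l g)) • g) (a := f)
      (by rw [huf, zero_smul])
    rw [h1, ← hlp, ← hwx]
    simp only [add_smul, mul_smul, sub_smul, Finset.sum_add_distrib, ← Finset.smul_sum,
      Finset.sum_sub_distrib]

lemma poly_cone (F : Finset E2) : ∀ p ∈ convexHull ℝ (F : Set E2), ∃ r > 0,
    ∀ x ∈ convexHull ℝ (F : Set E2), ∀ s : ℝ, 0 ≤ s → s * ‖x - p‖ ≤ r →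
      p + s • (x - p) ∈ convexHull ℝ (F : Set E2) := by
  induction F using Finset.strongInduction with
  | H F ih =>
    intro p hp
    have key : ∀ f : E2, ∃ r > 0, f ∈ F → ∀ y ∈ convexHull ℝ ((F.erase f : Finset E2) : Set E2),
        ∀ s : ℝ, 0 ≤ s → s * ‖y - p‖ ≤ r → p + s • (y - p) ∈ convexHull ℝ (F : Set E2) := by
      intro f
      by_cases hf : f ∈ F
      swap
      · exact ⟨1, one_pos, fun h => absurd h hf⟩
      have hsub : convexHull ℝ ((F.erase f : Finset E2) : Set E2) ⊆ convexHull ℝ (F : Set E2) :=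
        convexHull_mono (by exact_mod_cast Finset.erase_subset f F)
      by_cases hpf : p ∈ convexHull ℝ ((F.erase f : Finset E2) : Set E2)
      · obtain ⟨r, hr, h⟩ := ih _ (Finset.erase_ssubset hf) p hpf
        exact ⟨r, hr, fun _ y hy s hs hsr => hsub (h y hy s hs hsr)⟩
      · have hcl : IsClosed (convexHull ℝ ((F.erase f : Finset E2) : Set E2)) :=
          (Set.Finite.isCompact_convexHull (𝕜 := ℝ) (Finset.finite_toSet _)).isClosed
        have hop := hcl.isOpen_compl
        obtain ⟨r, hr, h⟩ := Metric.isOpen_iff.1 hop p hpf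
        refine ⟨r, hr, fun _ y hy s hs hsr => ?_⟩
        have hyr : r ≤ ‖y - p‖ := by
          by_contra hlt
          push Not at hlt
          exact h (by rwa [Metric.mem_ball, dist_eq_norm]) hy
        have hs1 : s ≤ 1 := by
          by_contra hlt
          push Not at hlt
          nlinarith
        have := (convex_convexHull ℝ (F : Set E2)) hp (hsub hy) (by linarith : 0 ≤ 1 - s) hs (by ring)
        convert this using 1
        module
    choose r hr h using key
    have hFne : F.Nonempty := by
      rw [Finset.nonempty_iff_ne_empty]; rintro rfl; simp at hp
    obtain ⟨f0, hf0, hmin⟩ := Finset.exists_min_image F r hFne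
    refine ⟨r f0, hr f0, fun x hx s hs hsr => ?_⟩
    by_cases hxp : x = p
    · subst hxp; simpa using hx
    obtain ⟨f, hf, τ, hτ, hy⟩ := ray_exit F hp hx hxp
    have hτ0 : 0 < τ := by linarith
    have := h f hf _ hy (s / τ) (by positivity) (by
      rw [add_sub_cancel_left, norm_smul, Real.norm_of_nonneg hτ0.le]
      have : s / τ * (τ * ‖x - p‖) = s * ‖x - p‖ := by field_simp
      rw [this]; exact hsr.trans (hmin f hf))
    rw [add_sub_cancel_left, smul_smul, div_mul_cancel₀ _ hτ0.ne'] at this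
    exact this

def PolyU (X : Set E2) : Prop :=
  ∃ (n : ℕ) (P : Fin n → Finset E2), X = ⋃ i, convexHull ℝ (↑(P i) : Set E2)

structure IsChart (X : Set E2) (p : E2) (R : ℝ) (C : Set E2) : Prop where
  pos : 0 < R
  cone : IsCone C
  mem_iff : ∀ v : E2, ‖v‖ < R → (v ∈ C ↔ p + v ∈ X)

lemma IsChart.mono {X : Set E2} {p : E2} {R R' : ℝ} {C : Set E2} (h : IsChart X p R C)
    (h0 : 0 < R') (hR : R' ≤ R) : IsChart X p R' C :=
  ⟨h0, h.cone, fun v hv => h.mem_iff v (hv.trans_le hR)⟩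

lemma exists_chart {X : Set E2} (hX : PolyU X) {p : E2} (hp : p ∈ X) :
    ∃ R C, IsChart X p R C := by
  obtain ⟨n, P, rfl⟩ := hX
  have key : ∀ i : Fin n, ∃ r > 0, ∀ x ∈ convexHull ℝ (P i : Set E2), ‖x - p‖ < r →
      ∀ s : ℝ, 0 ≤ s → s * ‖x - p‖ < r → p + s • (x - p) ∈ convexHull ℝ (P i : Set E2) := by
    intro i
    by_cases hpi : p ∈ convexHull ℝ (P i : Set E2)
    · obtain ⟨r, hr, h⟩ := poly_cone _ p hpi
      exact ⟨r, hr, fun x hx _ s hs hsr => h x hx s hs hsr.le⟩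
    · have hcl : IsClosed (convexHull ℝ (P i : Set E2)) :=
        (Set.Finite.isCompact_convexHull (𝕜 := ℝ) (Finset.finite_toSet _)).isClosed
      obtain ⟨r, hr, h⟩ := Metric.isOpen_iff.1 hcl.isOpen_compl p hpi
      refine ⟨r, hr, fun y hy hyr => ?_⟩
      exact absurd hy (h (by rwa [Metric.mem_ball, dist_eq_norm]))
  choose r hr h using key
  obtain ⟨i0, _⟩ := Set.mem_iUnion.1 hp
  obtain ⟨j, _, hmin⟩ := Finset.exists_min_image Finset.univ r ⟨i0, Finset.mem_univ _⟩
  set X := ⋃ i, convexHull ℝ (P i : Set E2)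
  have hX : ∀ x ∈ X, ‖x - p‖ < r j → ∀ s : ℝ, 0 ≤ s → s * ‖x - p‖ < r j → p + s • (x - p) ∈ X := by
    intro x hx hxr s hs hsr
    obtain ⟨i, hi⟩ := Set.mem_iUnion.1 hx
    have := hmin i (Finset.mem_univ _)
    exact Set.mem_iUnion.2 ⟨i, h i x hi (hxr.trans_le this) s hs (hsr.trans_le this)⟩
  refine ⟨r j, {v | ∃ s : ℝ, 0 < s ∧ ‖s • v‖ < r j ∧ p + s • v ∈ X}, hr j, ?_, ?_⟩
  · rintro v ⟨s, hs, hsr, hm⟩ t ht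
    rcases ht.eq_or_lt with rfl | ht
    · exact ⟨1, one_pos, by simpa using hr j, by simpa using hp⟩
    · refine ⟨s / t, by positivity, ?_, ?_⟩ <;> rw [smul_smul, div_mul_cancel₀ _ ht.ne'] <;> assumption
  · intro v hv
    constructor
    · rintro ⟨s, hs, hsr, hm⟩
      have := hX _ hm (by simpa using hsr) (1 / s) (by positivity) (by
        rw [add_sub_cancel_left, norm_smul, Real.norm_of_nonneg hs.le]
        field_simp; exact hv)
      rw [add_sub_cancel_left, smul_smul, one_div_mul_cancel hs.ne', one_smul] at this
      exact this
    · intro hm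
      exact ⟨1, one_pos, by simpa using hv, by simpa using hm⟩

lemma IsChart.seg {X : Set E2} {p : E2} {R : ℝ} {C : Set E2} (h : IsChart X p R C) {y : E2}
    (hy : y ∈ X) (hyR : ‖y - p‖ < R) : segment ℝ p y ⊆ X := by
  have hyC : y - p ∈ C := (h.mem_iff _ hyR).2 (by simpa using hy)
  rintro _ ⟨a, b, ha, hb, hab, rfl⟩
  have h1 := h.cone _ hyC b hb
  have h2 := (h.mem_iff (b • (y - p)) (by
    rw [norm_smul, Real.norm_of_nonneg hb]
    have : b ≤ 1 := by linarith
    nlinarith [norm_nonneg (y - p)])).1 h1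
  convert h2 using 1
  rw [← eq_sub_iff_add_eq] at hab
  subst hab; module


end

section
open unitInterval

lemma Icc_univ_I : (Set.Iic (⟨1/2, by norm_num, by norm_num⟩ : I)) ∪ Set.Ici ⟨1/2, by norm_num, by norm_num⟩ = Set.univ :=
  Set.Iic_union_Ici

lemma cost_trans {X : Set E2} {a b c : X} (γ : Path a b) (γ' : Path b c) :
    cost (γ.trans γ') ≤ cost γ + cost γ' := by
  unfold cost
  set h : I := ⟨1/2, by norm_num, by norm_num⟩ with hh
  rw [← Set.Iic_union_Ici (a := h), eVariationOn.union _ isGreatest_Iic isLeast_Ici]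
  refine add_le_add ?_ ?_
  · rw [Set.Iic_union_Ici]
    let φ : I → I := fun t => Set.projIcc (0:ℝ) 1 zero_le_one (2 * t.1)
    have hφ : Monotone φ := fun s t hst => Set.monotone_projIcc _ (by
      have : s.1 ≤ t.1 := hst
      linarith)
    refine le_trans (le_of_eq ?_) (eVariationOn.comp_le_of_monotoneOn (fun t => (γ t : E2)) φ
      (hφ.monotoneOn (Set.Iic h)) (Set.mapsTo_univ _ _))
    apply eVariationOn.congr
    intro t ht
    have ht' : t.1 ≤ 1/2 := ht
    simp only [Path.trans_apply, Function.comp, φ]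
    rw [dif_pos ht', Set.projIcc_of_mem _ ⟨by linarith [t.2.1], by linarith⟩]
  · rw [Set.Iic_union_Ici]
    let φ : I → I := fun t => Set.projIcc (0:ℝ) 1 zero_le_one (2 * t.1 - 1)
    have hφ : Monotone φ := fun s t hst => Set.monotone_projIcc _ (by
      have : s.1 ≤ t.1 := hst
      linarith)
    refine le_trans (le_of_eq ?_) (eVariationOn.comp_le_of_monotoneOn (fun t => (γ' t : E2)) φ
      (hφ.monotoneOn (Set.Ici h)) (Set.mapsTo_univ _ _))
    apply eVariationOn.congr
    intro t ht
    have ht' : 1/2 ≤ t.1 := ht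
    simp only [Path.trans_apply, Function.comp, φ]
    rw [Set.projIcc_of_mem _ ⟨by linarith [t.2.1], by linarith [t.2.2]⟩]
    split_ifs with h2
    · have : t.1 = 1/2 := le_antisymm h2 ht'
      have e1 : (⟨2 * t.1, by constructor <;> linarith [t.2.1]⟩ : I) = 1 := Subtype.ext (by simp [this])
      have e2 : (⟨2 * t.1 - 1, by constructor <;> linarith [t.2.2]⟩ : I) = 0 := Subtype.ext (by simp [this])
      rw [e1, e2]; simp
    · rfl

lemma cost_symm_le {X : Set E2} {a b : X} (γ : Path a b) : cost γ.symm ≤ cost γ := by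
  unfold cost
  have hφ : Antitone (fun t : I => σ t) := fun s t hst => by
    have : s.1 ≤ t.1 := hst
    show (1 - t.1 : ℝ) ≤ 1 - s.1
    linarith
  exact eVariationOn.comp_le_of_antitoneOn (fun t => (γ t : E2)) (fun t : I => σ t)
      (hφ.antitoneOn (Set.univ)) (Set.mapsTo_univ _ _)

lemma cost_symm {X : Set E2} {a b : X} (γ : Path a b) : cost γ.symm = cost γ :=
  le_antisymm (cost_symm_le γ) (by simpa using cost_symm_le γ.symm)

lemma cost_refl {X : Set E2} (a : X) : cost (Path.refl a) = 0 := by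
  unfold cost
  apply eVariationOn.constant_on
  rintro _ ⟨s, _, rfl⟩ _ ⟨t, _, rfl⟩
  rfl

lemma cost_cast {X : Set E2} {a b a' b' : X} (γ : Path a b) (ha : a' = a) (hb : b' = b) :
    cost (γ.cast ha hb) = cost γ := rfl

lemma edist_le_cost {X : Set E2} {a b : X} (γ : Path a b) (s t : I) :
    edist (γ s : E2) (γ t) ≤ cost γ :=
  eVariationOn.edist_le (fun t => (γ t : E2)) (Set.mem_univ _) (Set.mem_univ _)

lemma edist_ends_le {X : Set E2} {a b : X} (γ : Path a b) : edist (a : E2) b ≤ cost γ := by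
  simpa using edist_le_cost γ 0 1

lemma cost_line {X : Set E2} {x y : E2} (hx : x ∈ X) (hy : y ∈ X) (h : segment ℝ x y ⊆ X) :
    cost (linePath hx hy h) ≤ ENNReal.ofReal ‖x - y‖ := by
  have hL : LipschitzOnWith (Real.toNNReal ‖x - y‖) (fun t : ℝ => (1 - t) • x + t • y) Set.univ := by
    rw [lipschitzOnWith_univ]
    refine LipschitzWith.of_dist_le_mul fun s t => ?_
    rw [dist_eq_norm, dist_eq_norm]
    have : (1 - s) • x + s • y - ((1 - t) • x + t • y) = (t - s) • (x - y) := by module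
    rw [this, norm_smul, mul_comm, norm_sub_rev t s, Real.coe_toNNReal _ (norm_nonneg _)]
  have h1 := hL.comp_eVariationOn_le (g := fun t : I => t.1) (s := Set.univ) (Set.mapsTo_univ _ _)
  have h2 : eVariationOn (fun t : I => t.1) Set.univ ≤ 1 := by
    have hm : MonotoneOn (fun t : I => t.1) Set.univ := fun s _ t _ h => h
    have := hm.eVariationOn_eq (Set.mem_univ (0:I)) (Set.mem_univ (1:I))
    have e : (Set.univ ∩ Set.Icc (0:I) 1) = Set.univ := by
      ext t; exact ⟨fun _ => trivial, fun _ => ⟨trivial, t.2.1, t.2.2⟩⟩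
    rw [e] at this
    rw [this]; simp
  calc cost (linePath hx hy h) ≤ _ := h1
    _ ≤ _ := by
      grw [h2, mul_one]
      exact le_rfl

/-- two sides of an intermediate point -/
lemma edist_add_le {X : Set E2} {a b : X} (γ : Path a b) (t : I) :
    edist (a : E2) (γ t) + edist (γ t : E2) b ≤ cost γ := by
  unfold cost
  rw [← Set.Iic_union_Ici (a := t), eVariationOn.union _ isGreatest_Iic isLeast_Ici]
  refine add_le_add ?_ ?_
  · simpa using eVariationOn.edist_le (fun t => (γ t : E2)) (s := Set.Iic t) (x := 0) (y := t)
      t.2.1 Set.self_mem_Iic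
  · simpa using eVariationOn.edist_le (fun t => (γ t : E2)) (s := Set.Ici t) (x := t) (y := 1)
      Set.self_mem_Ici t.2.2

lemma I_induction (P : I → Prop) (h0 : P 0)
    (hloc : ∀ t : I, ∃ ε > 0, ∀ s : I, dist s t < ε → (s ≤ t → P s → P t) ∧ (t ≤ s → P t → P s)) :
    P 1 := by
  have hcl : IsClopen {t : I | ∀ s ≤ t, P s} := by
    constructor
    · rw [← isSeqClosed_iff_isClosed]
      intro u t hu hut
      have hlt : ∀ r < t, P r := by
        intro r hr
        obtain ⟨n, hn⟩ := ((hut.eventually (lt_mem_nhds hr))).exists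
        exact hu n r hn.le
      intro s hs
      rcases hs.eq_or_lt with rfl | hs
      · obtain ⟨ε, hε, h⟩ := hloc s
        obtain ⟨n, hn⟩ := (hut.eventually (Metric.ball_mem_nhds _ hε)).exists
        rcases le_total (u n) s with hh | hh
        · exact (h _ hn).1 hh (hu n _ le_rfl)
        · exact hu n _ hh
      · exact hlt s hs
    · rw [Metric.isOpen_iff]
      intro t ht
      obtain ⟨ε, hε, h⟩ := hloc t
      refine ⟨ε, hε, fun s hs r hr => ?_⟩
      rcases le_total r t with hh | hh
      · exact ht r hh
      · refine (h r ?_).2 hh (ht t le_rfl)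
        have h1 : r.1 ≤ s.1 := hr
        have h2 : t.1 ≤ r.1 := hh
        have h3 : |s.1 - t.1| < ε := hs
        show |r.1 - t.1| < ε
        rw [abs_of_nonneg (by linarith)] at h3 ⊢
        linarith
  have := hcl.eq_univ ⟨0, fun s hs => by
    have : s = 0 := le_antisymm hs s.2.1
    rw [this]; exact h0⟩
  have h1 : (1 : I) ∈ {t : I | ∀ s ≤ t, P s} := by rw [this]; trivial
  exact h1 1 le_rfl

lemma chart_mem {X : Set E2} {p : E2} {R : ℝ} {C : Set E2} (h : IsChart X p R C) {y : E2}
    (hy : y ∈ X) (hyR : ‖y - p‖ < R) : y - p ∈ C :=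
  (h.mem_iff _ hyR).2 (by simpa using hy)

lemma ball_conv {x y p : E2} {R : ℝ} (hx : ‖x - p‖ < R) (hy : ‖y - p‖ < R) {z : E2}
    (hz : z ∈ segment ℝ x y) : ‖z - p‖ < R := by
  have := (convex_ball p R).segment_subset (x := x) (y := y) (by simpa [dist_eq_norm] using hx)
    (by simpa [dist_eq_norm] using hy) hz
  simpa [dist_eq_norm] using this

lemma vis_chart {X : Set E2} {p : E2} {R : ℝ} {C : Set E2} (h : IsChart X p R C) {x y : E2}
    (hx : ‖x - p‖ < R) (hy : ‖y - p‖ < R) : Vis C (x - p) (y - p) ↔ segment ℝ x y ⊆ X := by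
  constructor
  · intro hv z hz
    have hz' : z - p ∈ segment ℝ (x - p) (y - p) := by
      obtain ⟨a, b, ha, hb, hab, rfl⟩ := hz
      refine ⟨a, b, ha, hb, hab, ?_⟩
      rw [← eq_sub_iff_add_eq] at hab
      subst hab; module
    have := (h.mem_iff _ (ball_conv hx hy hz)).1 (hv hz')
    simpa using this
  · rintro hs _ ⟨a, b, ha, hb, hab, rfl⟩
    have hz : a • x + b • y ∈ segment ℝ x y := ⟨a, b, ha, hb, hab, rfl⟩
    have := chart_mem h (hs hz) (ball_conv hx hy hz)
    convert this using 1
    rw [← eq_sub_iff_add_eq] at hab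
    subst hab; module

lemma cd_le_cost {X : Set E2} (hX : PolyU X) {p : E2} {R : ℝ} {C : Set E2} (h : IsChart X p R C)
    {a b : X} (γ : Path a b) (hγ : ∀ t, ‖(γ t : E2) - p‖ < R) :
    ENNReal.ofReal (cd C (a - p) (b - p)) ≤ cost γ := by
  set f : I → E2 := fun t => (γ t : E2) with hf
  have hmem : ∀ t, f t - p ∈ C := fun t => chart_mem h (γ t).2 (hγ t)
  have hstep : ∀ s t : I, s ≤ t → Vis C (f s - p) (f t - p) →
      ENNReal.ofReal (cd C (a - p) (f s - p)) ≤ eVariationOn f (Set.univ ∩ Set.Icc 0 s) →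
      ENNReal.ofReal (cd C (a - p) (f t - p)) ≤ eVariationOn f (Set.univ ∩ Set.Icc 0 t) := by
    intro s t hst hv hs
    rw [← eVariationOn.Icc_add_Icc f (s := Set.univ) (b := s) s.2.1 hst trivial]
    have ha : (a : E2) - p ∈ C := by simpa [f] using hmem 0
    have htri := cd_triangle h.cone (b := f s - p) ha (hmem t)
    refine (ENNReal.ofReal_le_ofReal htri).trans ?_
    rw [ENNReal.ofReal_add (cd_nonneg _ _ _) (cd_nonneg _ _ _)]
    refine add_le_add hs ?_
    rw [cd_vis hv, sub_sub_sub_cancel_right, ← dist_eq_norm, ← edist_dist]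
    exact eVariationOn.edist_le f ⟨trivial, le_rfl, hst⟩ ⟨trivial, hst, le_rfl⟩
  have key := I_induction (fun t => ENNReal.ofReal (cd C (a - p) (f t - p)) ≤
    eVariationOn f (Set.univ ∩ Set.Icc 0 t)) ?_ ?_
  · have e : (Set.univ ∩ Set.Icc (0:I) 1) = Set.univ := by
      ext t; exact ⟨fun _ => trivial, fun _ => ⟨trivial, t.2.1, t.2.2⟩⟩
    rw [e] at key
    simpa [f, cost] using key
  · have : cd C (a - p) (f 0 - p) = 0 := by
      have e : f 0 = a := by simp [f]
      have ha : (a : E2) - p ∈ C := by simpa [f] using hmem 0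
      rw [e, cd_vis, sub_self, norm_zero]
      have := vis_ray h.cone ha (x := 1) (y := 1) zero_le_one zero_le_one
      simpa using this
    simp [this]
  · intro t
    obtain ⟨r, C', hC'⟩ := exists_chart hX (γ t).2
    have hc : Continuous f := continuous_subtype_val.comp γ.continuous
    obtain ⟨ε, hε, hd⟩ := Metric.continuous_iff.1 hc t r hC'.pos
    refine ⟨ε, hε, fun s hs => ?_⟩
    have hv : Vis C (f t - p) (f s - p) := by
      rw [vis_chart h (hγ t) (hγ s)]
      exact hC'.seg (γ s).2 (by simpa [dist_eq_norm] using hd s hs)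
    exact ⟨fun hst => hstep s t hst hv.symm, fun hst => hstep t s hst hv⟩

lemma homotopic_in_chart {X : Set E2} {p : E2} {R : ℝ} {C : Set E2}
    (h : IsChart X p R C) {a b : X} (γ γ' : Path a b) (hγ : ∀ t, ‖(γ t : E2) - p‖ < R)
    (hγ' : ∀ t, ‖(γ' t : E2) - p‖ < R) : γ.Homotopic γ' := by
  set W : Set E2 := X ∩ Metric.ball p R with hW
  have hst : StarConvex ℝ p W := by
    rw [starConvex_iff_segment_subset]
    rintro y ⟨hy, hyR⟩
    have hyR' : ‖y - p‖ < R := by simpa [dist_eq_norm] using hyR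
    intro z hz
    refine ⟨h.seg hy hyR' hz, ?_⟩
    have := ball_conv (by simpa using h.pos) hyR' hz
    simpa [dist_eq_norm] using this
  have hmem : ∀ (δ : Path a b) (_ : ∀ t, ‖(δ t : E2) - p‖ < R) t, (δ t : E2) ∈ W := fun δ hδ t =>
    ⟨(δ t).2, by simpa [dist_eq_norm] using hδ t⟩
  have ha : (a : E2) ∈ W := by simpa using hmem γ hγ 0
  have hb : (b : E2) ∈ W := by simpa using hmem γ hγ 1
  have := hst.contractibleSpace ⟨_, ha⟩
  let L : ∀ (δ : Path a b) (_ : ∀ t, ‖(δ t : E2) - p‖ < R), Path (⟨a, ha⟩ : W) ⟨b, hb⟩ := fun δ hδ =>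
    { toFun := fun t => ⟨δ t, hmem δ hδ t⟩
      continuous_toFun := by fun_prop
      source' := Subtype.ext (by simp)
      target' := Subtype.ext (by simp) }
  let ι : C(W, X) := ⟨fun w => ⟨w.1, w.2.1⟩, by fun_prop⟩
  exact (SimplyConnectedSpace.paths_homotopic (L γ hγ) (L γ' hγ')).map ι


end

section
open unitInterval
open Path.Homotopic.Quotient (mk)

abbrev UC {X : Set E2} (x0 : X) : Type := Σ y : X, Path.Homotopic.Quotient x0 y

def DD {X : Set E2} {x0 : X} (a b : UC x0) : ENNReal :=
  ⨅ (γ : Path a.1 b.1) (_ : a.2.trans (mk γ) = b.2), cost γ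

section
variable {X : Set E2} {x0 : X}

lemma DD_le {a b : UC x0} (γ : Path a.1 b.1) (h : a.2.trans (mk γ) = b.2) : DD a b ≤ cost γ :=
  iInf₂_le γ h

lemma exists_of_DD_lt {a b : UC x0} {c : ENNReal} (h : DD a b < c) :
    ∃ γ : Path a.1 b.1, a.2.trans (mk γ) = b.2 ∧ cost γ < c := by
  unfold DD at h
  simp only [iInf_lt_iff] at h
  obtain ⟨γ, h1, h2⟩ := h
  exact ⟨γ, h1, h2⟩

lemma class_symm {a b : UC x0} {γ : Path a.1 b.1} (h : a.2.trans (mk γ) = b.2) :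
    b.2.trans (mk γ.symm) = a.2 := by
  rw [← h, Path.Homotopic.Quotient.mk_symm, Path.Homotopic.Quotient.trans_assoc,
    Path.Homotopic.Quotient.trans_symm, Path.Homotopic.Quotient.trans_refl]

lemma class_trans {a b c : UC x0} {γ : Path a.1 b.1} {γ' : Path b.1 c.1}
    (h : a.2.trans (mk γ) = b.2) (h' : b.2.trans (mk γ') = c.2) :
    a.2.trans (mk (γ.trans γ')) = c.2 := by
  rw [← h', ← h, Path.Homotopic.Quotient.mk_trans, Path.Homotopic.Quotient.trans_assoc]

lemma class_unique {a b : UC x0} {γ γ' : Path a.1 b.1} (h : a.2.trans (mk γ) = b.2)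
    (h' : a.2.trans (mk γ') = b.2) : γ.Homotopic γ' := by
  rw [← Path.Homotopic.Quotient.eq]
  have : a.2.symm.trans (a.2.trans (mk γ)) = a.2.symm.trans (a.2.trans (mk γ')) := by rw [h, h']
  simpa only [← Path.Homotopic.Quotient.trans_assoc, Path.Homotopic.Quotient.symm_trans,
    Path.Homotopic.Quotient.refl_trans] using this

lemma class_congr {a b : UC x0} {γ γ' : Path a.1 b.1} (h : a.2.trans (mk γ) = b.2)
    (h' : γ.Homotopic γ') : a.2.trans (mk γ') = b.2 := by
  rw [← h, Path.Homotopic.Quotient.eq.2 h']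

lemma DD_self (a : UC x0) : DD a a = 0 := by
  refine le_antisymm ?_ zero_le
  refine (DD_le (Path.refl a.1) ?_).trans (cost_refl a.1).le
  rw [Path.Homotopic.Quotient.mk_refl, Path.Homotopic.Quotient.trans_refl]

lemma DD_symm_le (a b : UC x0) : DD a b ≤ DD b a := by
  refine le_iInf₂ fun γ h => ?_
  rw [← cost_symm]
  exact DD_le _ (class_symm h)

lemma DD_symm (a b : UC x0) : DD a b = DD b a := le_antisymm (DD_symm_le a b) (DD_symm_le b a)

lemma DD_triangle (a b c : UC x0) : DD a c ≤ DD a b + DD b c := by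
  unfold DD
  simp_rw [ENNReal.iInf_add, ENNReal.add_iInf]
  refine le_iInf₂ fun γ h => le_iInf₂ fun γ' h' => ?_
  exact (DD_le _ (class_trans h h')).trans (cost_trans _ _)

lemma edist_le_DD (a b : UC x0) : edist (a.1 : E2) b.1 ≤ DD a b :=
  le_iInf₂ fun γ _ => edist_ends_le γ

lemma dist_lt_of_DD {a b : UC x0} {δ : ℝ} (h : DD a b < ENNReal.ofReal δ) :
    ‖(b.1 : E2) - a.1‖ < δ := by
  have := (edist_le_DD a b).trans_lt h
  rw [edist_dist, ENNReal.ofReal_lt_ofReal_iff'] at this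
  rw [← dist_eq_norm, dist_comm]; exact this.1

/-- locality in a ball -/
def Loc (p : E2) (R : ℝ) (a z : UC x0) : Prop :=
  ∃ γ : Path a.1 z.1, (∀ t, ‖(γ t : E2) - p‖ < R) ∧ a.2.trans (mk γ) = z.2

lemma Loc.symm {p : E2} {R : ℝ} {a z : UC x0} (h : Loc p R a z) : Loc p R z a := by
  obtain ⟨γ, h1, h2⟩ := h
  exact ⟨γ.symm, fun t => h1 _, class_symm h2⟩

lemma trans_ball {p : E2} {R : ℝ} {a b c : X} (γ : Path a b) (γ' : Path b c)
    (h : ∀ t, ‖(γ t : E2) - p‖ < R) (h' : ∀ t, ‖(γ' t : E2) - p‖ < R) (t : I) :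
    ‖((γ.trans γ') t : E2) - p‖ < R := by
  rw [Path.trans_apply]
  split_ifs
  · exact h _
  · exact h' _

lemma Loc.trans {p : E2} {R : ℝ} {a b c : UC x0} (h : Loc p R a b) (h' : Loc p R b c) :
    Loc p R a c := by
  obtain ⟨γ, h1, h2⟩ := h
  obtain ⟨γ', h1', h2'⟩ := h'
  exact ⟨γ.trans γ', trans_ball _ _ h1 h1', class_trans h2 h2'⟩

lemma loc_of_DD {p : E2} {R δ : ℝ} {a z : UC x0} (h : DD a z < ENNReal.ofReal δ)
    (hR : ∀ y : E2, ‖y - a.1‖ < δ → ‖y - p‖ < R) : Loc p R a z := by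
  obtain ⟨γ, h1, h2⟩ := exists_of_DD_lt h
  refine ⟨γ, fun t => hR _ ?_, h1⟩
  have := (edist_le_cost γ t 0).trans_lt h2
  rw [edist_dist, ENNReal.ofReal_lt_ofReal_iff', dist_eq_norm] at this
  simpa using this.1

lemma line_ball {p x y : E2} {R : ℝ} (hx : x ∈ X) (hy : y ∈ X) (h : segment ℝ x y ⊆ X)
    (hxR : ‖x - p‖ < R) (hyR : ‖y - p‖ < R) (t : I) : ‖(linePath hx hy h t : E2) - p‖ < R :=
  ball_conv hxR hyR (by rw [segment_eq_image]; exact ⟨t.1, t.2, rfl⟩)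

lemma IsChart.center {p : E2} {R : ℝ} {C : Set E2} (h : IsChart X p R C) {y : E2}
    (hy : y ∈ X) (hyR : ‖y - p‖ < R) : p ∈ X := h.seg hy hyR (left_mem_segment ℝ p y)

/-- path through the center -/
lemma center_path {p : E2} {R : ℝ} {C : Set E2} (h : IsChart X p R C) (x y : X)
    (hx : ‖(x : E2) - p‖ < R) (hy : ‖(y : E2) - p‖ < R) :
    ∃ γ : Path x y, (∀ t, ‖(γ t : E2) - p‖ < R) ∧
      cost γ ≤ ENNReal.ofReal (‖(x : E2) - p‖ + ‖(y : E2) - p‖) := by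
  have hp := h.center x.2 hx
  have h0 : ‖p - p‖ < R := by simpa using h.pos
  have s1 : segment ℝ (x : E2) p ⊆ X := by rw [segment_symm]; exact h.seg x.2 hx
  refine ⟨(linePath x.2 hp s1).trans (linePath hp y.2 (h.seg y.2 hy)), ?_, ?_⟩
  · exact trans_ball _ _ (line_ball _ _ _ hx h0) (line_ball _ _ _ h0 hy)
  · refine (cost_trans _ _).trans ?_
    rw [ENNReal.ofReal_add (norm_nonneg _) (norm_nonneg _)]
    refine add_le_add (cost_line _ _ _) ?_
    rw [norm_sub_rev]; exact cost_line _ _ _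

lemma DD_eq_cd (hX : PolyU X) {p : E2} {R : ℝ} {C : Set E2} (h : IsChart X p R C) {z w : UC x0}
    (hl : Loc p R z w) (hz : ‖(z.1 : E2) - p‖ < R / 8) (hw : ‖(w.1 : E2) - p‖ < R / 8) :
    DD z w = ENNReal.ofReal (cd C (z.1 - p) (w.1 - p)) := by
  have hR := h.pos
  have hz' : ‖(z.1 : E2) - p‖ < R := by linarith
  have hw' : ‖(w.1 : E2) - p‖ < R := by linarith
  apply le_antisymm
  · obtain ⟨γ, h1, h2⟩ := hl
    by_cases hv : Vis C ((z.1 : E2) - p) (w.1 - p)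
    · have hs := (vis_chart h hz' hw').1 hv
      refine (DD_le (linePath z.1.2 w.1.2 hs) ?_).trans ?_
      · exact class_congr h2 (homotopic_in_chart h _ _ h1 (line_ball _ _ _ hz' hw'))
      · rw [cd_vis hv, sub_sub_sub_cancel_right]; exact cost_line _ _ _
    · obtain ⟨γ', h1', h2'⟩ := center_path h z.1 w.1 hz' hw'
      rw [cd_not hv]
      exact (DD_le γ' (class_congr h2 (homotopic_in_chart h _ _ h1 h1'))).trans h2'
  · refine le_iInf₂ fun γ hγ => ?_
    by_cases hb : ∀ t, ‖(γ t : E2) - p‖ < R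
    · exact cd_le_cost hX h γ hb
    · push Not at hb
      obtain ⟨t, ht⟩ := hb
      refine le_trans ?_ (edist_le_cost γ t 0)
      rw [edist_dist]
      apply ENNReal.ofReal_le_ofReal
      have h1 := cd_le C ((z.1 : E2) - p) (w.1 - p)
      rw [dist_eq_norm]
      have h2 : ‖(γ t : E2) - p‖ ≤ ‖(γ t : E2) - γ 0‖ + ‖(γ 0 : E2) - p‖ :=
        norm_sub_le_norm_sub_add_norm_sub _ _ _
      have h3 : ‖(γ 0 : E2) - p‖ = ‖(z.1 : E2) - p‖ := by simp
      linarith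

lemma exists_loc {p : E2} {R : ℝ} {C : Set E2} (h : IsChart X p R C) {z : UC x0} {m : E2}
    (hm : m ∈ X) (hz : ‖(z.1 : E2) - p‖ < R) (hmR : ‖m - p‖ < R) :
    ∃ w : UC x0, (w.1 : E2) = m ∧ Loc p R z w := by
  obtain ⟨γ, h1, h2⟩ := center_path h z.1 ⟨m, hm⟩ hz hmR
  exact ⟨⟨⟨m, hm⟩, z.2.trans (mk γ)⟩, rfl, γ, h1, rfl⟩

lemma lebesgue_chart (hc : IsCompact X) (hX : PolyU X) {η : ℝ} (hη : 0 < η) :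
    ∃ δ > 0, ∀ x ∈ X, ∃ p R C, IsChart X p R C ∧ R ≤ η ∧ ∀ y : E2, ‖y - x‖ < δ → ‖y - p‖ < R / 8 := by
  have key : ∀ p : X, ∃ R C, IsChart X p R C ∧ R ≤ η := by
    intro p
    obtain ⟨R, C, h⟩ := exists_chart hX p.2
    exact ⟨min R η, C, h.mono (lt_min h.pos hη) (min_le_left _ _), min_le_right _ _⟩
  choose R C h hR using key
  obtain ⟨δ, hδ, hL⟩ := lebesgue_number_lemma_of_metric hc
    (c := fun p : X => Metric.ball (p : E2) (R p / 8)) (fun _ => Metric.isOpen_ball)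
    (fun x hx => Set.mem_iUnion.2 ⟨⟨x, hx⟩, Metric.mem_ball_self (by have := (h ⟨x, hx⟩).pos; positivity)⟩)
  refine ⟨δ, hδ, fun x hx => ?_⟩
  obtain ⟨p, hp⟩ := hL x hx
  refine ⟨p, R p, C p, h p, hR p, fun y hy => ?_⟩
  have := hp (show y ∈ Metric.ball x δ by rwa [Metric.mem_ball, dist_eq_norm])
  rwa [Metric.mem_ball, dist_eq_norm] at this

lemma DD_small (hc : IsCompact X) (hX : PolyU X) {η : ℝ} (hη : 0 < η) :
    ∃ δ > 0, ∀ (a b : UC x0) (β : Path a.1 b.1), (∀ t, ‖(β t : E2) - a.1‖ < δ) →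
      a.2.trans (mk β) = b.2 → DD a b ≤ ENNReal.ofReal η := by
  obtain ⟨δ, hδ, h⟩ := lebesgue_chart hc hX hη
  refine ⟨δ, hδ, fun a b β hβ hab => ?_⟩
  obtain ⟨p, R, C, hch, hR, hb⟩ := h a.1 a.1.2
  have hpos := hch.pos
  have h0 : ‖(a.1 : E2) - p‖ < R / 8 := hb _ (by simpa using hδ)
  have h1 : ‖(b.1 : E2) - p‖ < R / 8 := hb _ (by simpa using hβ 1)
  rw [DD_eq_cd hX hch ⟨β, fun t => (hb _ (hβ t)).trans (by linarith), hab⟩ h0 h1]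
  apply ENNReal.ofReal_le_ofReal
  have := cd_le C ((a.1 : E2) - p) (b.1 - p)
  linarith

def IsMid (a b m : UC x0) : Prop := DD a m ≤ DD a b / 2 ∧ DD m b ≤ DD a b / 2

lemma ofReal_half (x : ℝ) : ENNReal.ofReal x / 2 = ENNReal.ofReal (x / 2) := by
  rw [ENNReal.ofReal_div_of_pos two_pos]; simp

lemma DD_local (hc : IsCompact X) (hX : PolyU X) : ∃ ε > 0,
    (∀ a b : UC x0, DD a b < ENNReal.ofReal ε → ∃ m, IsMid a b m) ∧
    (∀ a b a' b' m m' : UC x0, DD a b < ENNReal.ofReal ε → DD a' b' < ENNReal.ofReal ε →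
      DD a a' < ENNReal.ofReal ε → IsMid a b m → IsMid a' b' m' →
      DD m m' ≤ (DD a a' + DD b b') / 2) := by
  obtain ⟨δ, hδ, h⟩ := lebesgue_chart hc hX one_pos
  have hε : ENNReal.ofReal (δ / 3) ≤ ENNReal.ofReal δ := ENNReal.ofReal_le_ofReal (by linarith)
  have half : ∀ x : ENNReal, x / 2 ≤ x := fun x => ENNReal.half_le_self
  refine ⟨δ / 3, by positivity, fun a b hab => ?_, fun a b a' b' m m' hab hab' haa' hm hm' => ?_⟩
  · obtain ⟨p, R, C, hch, hR, hB⟩ := h a.1 a.1.2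
    have hpos := hch.pos
    have hB' : ∀ y : E2, ‖y - a.1‖ < δ → ‖y - p‖ < R := fun y hy => (hB y hy).trans (by linarith)
    have hab' := hab.trans_le hε
    have hlb := loc_of_DD hab' hB'
    have ha8 : ‖(a.1 : E2) - p‖ < R / 8 := hB _ (by simpa using hδ)
    have hb8 : ‖(b.1 : E2) - p‖ < R / 8 := hB _ (dist_lt_of_DD hab')
    have eab := DD_eq_cd hX hch hlb ha8 hb8
    have haC := chart_mem hch a.1.2 (ha8.trans (by linarith))
    have hbC := chart_mem hch b.1.2 (hb8.trans (by linarith))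
    obtain ⟨v, hv⟩ := exists_isM hch.cone haC hbC
    have hvC := hv.mem hch.cone haC hbC
    have h1 := hv.cd_left hch.cone haC
    have h2 := hv.cd_right hch.cone hbC
    have h3 := le_cd C ((a.1 : E2) - p) v
    have h4 : cd C ((a.1 : E2) - p) (b.1 - p) < δ := by
      rw [eab, ENNReal.ofReal_lt_ofReal_iff hδ] at hab'; exact hab'
    have h5 := cd_nonneg C ((a.1 : E2) - p) (b.1 - p)
    have hv8 : ‖p + v - p‖ < R / 8 := hB _ (by
      have : p + v - (a.1 : E2) = -((a.1 : E2) - p - v) := by abel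
      rw [this, norm_neg]; linarith)
    have hvX : p + v ∈ X := (hch.mem_iff v (by simpa using hv8.trans (by linarith))).1 hvC
    obtain ⟨m, hm, hl⟩ := exists_loc hch (z := a) hvX (ha8.trans (by linarith)) (hv8.trans (by linarith))
    rw [← hm] at hv8
    have hmv : (m.1 : E2) - p = v := by rw [hm]; abel
    refine ⟨m, ?_, ?_⟩
    · rw [eab, DD_eq_cd hX hch hl ha8 hv8, ofReal_half, hmv]
      exact ENNReal.ofReal_le_ofReal h1
    · rw [eab, DD_eq_cd hX hch (hl.symm.trans hlb) hv8 hb8, ofReal_half, hmv]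
      exact ENNReal.ofReal_le_ofReal h2
  · obtain ⟨p, R, C, hch, hR, hB⟩ := h a.1 a.1.2
    have hpos := hch.pos
    have hB' : ∀ y : E2, ‖y - a.1‖ < δ → ‖y - p‖ < R := fun y hy => (hB y hy).trans (by linarith)
    have two : ∀ x y : ENNReal, x < ENNReal.ofReal (δ / 3) → y < ENNReal.ofReal (δ / 3) →
        x + y < ENNReal.ofReal δ := by
      intro x y hx hy
      refine (ENNReal.add_lt_add hx hy).trans_le ?_
      rw [← ENNReal.ofReal_add (by positivity) (by positivity)]
      exact ENNReal.ofReal_le_ofReal (by linarith)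
    have fin : ∀ z : UC x0, DD a z < ENNReal.ofReal δ → Loc p R a z ∧ ‖(z.1 : E2) - p‖ < R / 8 ∧
        (z.1 : E2) - p ∈ C := by
      intro z hz
      have := hB _ (dist_lt_of_DD hz)
      exact ⟨loc_of_DD hz hB', this, chart_mem hch z.1.2 (this.trans (by linarith))⟩
    have ha := fin a (by rw [DD_self]; simpa using hδ)
    have hb := fin b (hab.trans_le hε)
    have ha' := fin a' (haa'.trans_le hε)
    have hb' := fin b' ((DD_triangle a a' b').trans_lt (two _ _ haa' hab'))
    have hmm := fin m ((hm.1.trans (half _)).trans_lt (hab.trans_le hε))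
    have hmm' := fin m' ((DD_triangle a a' m').trans_lt
      (two _ _ haa' ((hm'.1.trans (half _)).trans_lt hab')))
    have eq : ∀ z w : UC x0, (Loc p R a z ∧ ‖(z.1 : E2) - p‖ < R / 8 ∧ (z.1 : E2) - p ∈ C) →
        (Loc p R a w ∧ ‖(w.1 : E2) - p‖ < R / 8 ∧ (w.1 : E2) - p ∈ C) →
        DD z w = ENNReal.ofReal (cd C (z.1 - p) (w.1 - p)) := fun z w hz hw =>
      DD_eq_cd hX hch (hz.1.symm.trans hw.1) hz.2.1 hw.2.1
    have mid : ∀ z w u : UC x0, (Loc p R a z ∧ ‖(z.1 : E2) - p‖ < R / 8 ∧ (z.1 : E2) - p ∈ C) →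
        (Loc p R a w ∧ ‖(w.1 : E2) - p‖ < R / 8 ∧ (w.1 : E2) - p ∈ C) →
        (Loc p R a u ∧ ‖(u.1 : E2) - p‖ < R / 8 ∧ (u.1 : E2) - p ∈ C) →
        IsMid z w u → IsM C (z.1 - p) (w.1 - p) (u.1 - p) := by
      intro z w u hz hw hu ⟨h1, h2⟩
      rw [eq z u hz hu, eq z w hz hw, ofReal_half,
        ENNReal.ofReal_le_ofReal_iff (by have := cd_nonneg C ((z.1:E2)-p) (w.1-p); positivity)] at h1
      rw [eq u w hu hw, eq z w hz hw, ofReal_half,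
        ENNReal.ofReal_le_ofReal_iff (by have := cd_nonneg C ((z.1:E2)-p) (w.1-p); positivity)] at h2
      exact isM_of hch.cone hz.2.2 hw.2.2 h1 h2
    rw [eq m m' hmm hmm', eq a a' ha ha', eq b b' hb hb',
      ← ENNReal.ofReal_add (cd_nonneg _ _ _) (cd_nonneg _ _ _), ofReal_half]
    apply ENNReal.ofReal_le_ofReal
    exact bus4 hch.cone ha.2.2 hb.2.2 ha'.2.2 hb'.2.2 (mid _ _ _ ha hb hmm hm)
      (mid _ _ _ ha' hb' hmm' hm')

end

end

section

section
variable {Y : Type*} (D : Y → Y → ENNReal)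

def Mid (a b m : Y) : Prop := D a m ≤ D a b / 2 ∧ D m b ≤ D a b / 2

structure MidSp (ε : ℝ) : Prop where
  self : ∀ a, D a a = 0
  tri : ∀ a b c, D a c ≤ D a b + D b c
  ex : ∀ a b, D a b < ENNReal.ofReal ε → ∃ m, Mid D a b m
  bus : ∀ a b a' b' m m', D a b < ENNReal.ofReal ε → D a' b' < ENNReal.ofReal ε →
      D a a' < ENNReal.ofReal ε → Mid D a b m → Mid D a' b' m' → D m m' ≤ (D a a' + D b b') / 2

/-- affine interpolation -/
def aff (N : ℕ) (A B : ℕ → ℝ) (i k : ℕ) : ℝ := (((N : ℝ) - k) * A i + k * B i) / N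

def wt (N k : ℕ) : ℝ := 1 + k * ((N : ℝ) - k)

def rho (N : ℕ) : ℝ := 1 - 1 / ((N : ℝ) ^ 2 + 1)

structure Good (n N : ℕ) (η : ℝ) (A B : ℕ → ℝ) (l r : ℕ → Y) (m : ℕ) (u : ℕ → ℕ → Y) : Prop where
  hor : ∀ i < n, ∀ k ≤ N, D (u i k) (u (i+1) k) ≤ ENNReal.ofReal η
  ver : ∀ i ≤ n, ∀ k < N, D (u i k) (u i (k+1)) ≤ ENNReal.ofReal η
  left : ∀ k ≤ N, u 0 k = l k
  right : ∀ k ≤ N, u n k = r k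
  bot : ∀ i < n, D (u i 0) (u (i+1) 0) ≤ ENNReal.ofReal (A i)
  top : ∀ i < n, D (u i N) (u (i+1) N) ≤ ENNReal.ofReal (B i)
  est : ∀ i < n, ∀ k ≤ N, D (u i k) (u (i+1) k) ≤
    ENNReal.ofReal (aff N A B i k + η * wt N k * rho N ^ m)

variable {D}

lemma half_add {x y : ENNReal} {a b c : ℝ} (ha : 0 ≤ a) (hb : 0 ≤ b) (hx : x ≤ ENNReal.ofReal a)
    (hy : y ≤ ENNReal.ofReal b) (hc : (a + b) / 2 ≤ c) : (x + y) / 2 ≤ ENNReal.ofReal c := by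
  calc (x + y) / 2 ≤ (ENNReal.ofReal a + ENNReal.ofReal b) / 2 := by gcongr
    _ = ENNReal.ofReal ((a + b) / 2) := by rw [← ENNReal.ofReal_add ha hb, ofReal_half]
    _ ≤ _ := ENNReal.ofReal_le_ofReal hc

lemma wt_ge {N k : ℕ} (h : k ≤ N) : 1 ≤ wt N k := by
  unfold wt
  have : (k : ℝ) ≤ N := by exact_mod_cast h
  have := mul_nonneg (Nat.cast_nonneg k : (0:ℝ) ≤ k) (by linarith : 0 ≤ (N:ℝ) - k)
  linarith

lemma rho_nonneg (N : ℕ) : 0 ≤ rho N := by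
  unfold rho
  rw [sub_nonneg, div_le_one (by positivity)]; nlinarith [sq_nonneg (N:ℝ)]

lemma rho_lt (N : ℕ) : rho N < 1 := by
  unfold rho
  have : 0 < 1 / ((N : ℝ) ^ 2 + 1) := by positivity
  linarith

lemma wt_step (N k : ℕ) (h : k + 1 ≤ N) :
    (wt N k + wt N (k + 2)) / 2 ≤ rho N * wt N (k + 1) := by
  have e : (wt N k + wt N (k + 2)) / 2 = wt N (k+1) - 1 := by
    unfold wt; push_cast; ring
  rw [e]
  have hw : wt N (k+1) ≤ (N:ℝ)^2 + 1 := by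
    unfold wt
    have : ((k+1 : ℕ) : ℝ) ≤ N := by exact_mod_cast h
    nlinarith [(Nat.cast_nonneg (k+1) : (0:ℝ) ≤ (k+1:ℕ))]
  unfold rho
  have : wt N (k+1) / ((N:ℝ)^2 + 1) ≤ 1 := by rw [div_le_one (by positivity)]; exact hw
  have e2 : (1 - 1 / ((N : ℝ) ^ 2 + 1)) * wt N (k+1) = wt N (k+1) - wt N (k+1) / ((N:ℝ)^2 + 1) := by
    ring
  rw [e2]; linarith

lemma aff_nonneg {N : ℕ} {A B : ℕ → ℝ} {i k : ℕ} (hA : 0 ≤ A i) (hB : 0 ≤ B i) (hk : k ≤ N) :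
    0 ≤ aff N A B i k := by
  unfold aff
  have : (k : ℝ) ≤ N := by exact_mod_cast hk
  have := mul_nonneg (by linarith : 0 ≤ (N:ℝ) - k) hA
  positivity

lemma aff_step (N : ℕ) (A B : ℕ → ℝ) (i k : ℕ) :
    (aff N A B i k + aff N A B i (k+2)) / 2 = aff N A B i (k+1) := by
  unfold aff; push_cast; ring

lemma good_step {ε η : ℝ} (hD : MidSp D ε) (hη : 0 ≤ η) (hηε : 2 * η < ε) {n N : ℕ} (hN : 0 < N)
    (hn : 0 < n)
    {A B : ℕ → ℝ} (hA : ∀ i, 0 ≤ A i) (hB : ∀ i, 0 ≤ B i) {l r : ℕ → Y}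
    (hl : ∀ k, k + 2 ≤ N → Mid D (l k) (l (k+2)) (l (k+1)))
    (hr : ∀ k, k + 2 ≤ N → Mid D (r k) (r (k+2)) (r (k+1))) {m : ℕ} {u : ℕ → ℕ → Y}
    (h : Good D n N η A B l r m u) : ∃ u', Good D n N η A B l r (m+1) u' := by
  have hε : 0 < ε := by linarith
  have hηlt : ENNReal.ofReal η < ENNReal.ofReal ε := by
    rw [ENNReal.ofReal_lt_ofReal_iff hε]; linarith
  have h2 : ∀ i ≤ n, ∀ k, k + 2 ≤ N → D (u i k) (u i (k+2)) ≤ ENNReal.ofReal (2 * η) := by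
    intro i hi k hk
    refine (hD.tri _ (u i (k+1)) _).trans ?_
    rw [two_mul, ENNReal.ofReal_add hη hη]
    exact add_le_add (h.ver i hi k (by omega)) (h.ver i hi (k+1) (by omega))
  have h2lt : ∀ i ≤ n, ∀ k, k + 2 ≤ N → D (u i k) (u i (k+2)) < ENNReal.ofReal ε := by
    intro i hi k hk
    refine (h2 i hi k hk).trans_lt ?_
    rw [ENNReal.ofReal_lt_ofReal_iff hε]; linarith
  have hex : ∀ i k : ℕ, ∃ y : Y, (i ≤ n → k + 2 ≤ N → Mid D (u i k) (u i (k+2)) y) ∧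
      (i = 0 → k + 2 ≤ N → y = l (k+1)) ∧ (i = n → k + 2 ≤ N → y = r (k+1)) := by
    intro i k
    by_cases hk : k + 2 ≤ N
    swap
    · exact ⟨u i k, fun _ h => absurd h hk, fun _ h => absurd h hk, fun _ h => absurd h hk⟩
    by_cases h0 : i = 0
    · subst h0
      refine ⟨l (k+1), fun _ _ => ?_, fun _ _ => rfl, fun h => absurd h hn.ne⟩
      rw [h.left _ (by omega), h.left _ (by omega)]; exact hl k hk
    by_cases h1 : i = n
    · subst h1
      refine ⟨r (k+1), fun _ _ => ?_, fun h => absurd h h0, fun _ _ => rfl⟩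
      rw [h.right _ (by omega), h.right _ (by omega)]; exact hr k hk
    by_cases hi : i ≤ n
    · obtain ⟨y, hy⟩ := hD.ex _ _ (h2lt i hi k hk)
      exact ⟨y, fun _ _ => hy, fun h => absurd h h0, fun h => absurd h h1⟩
    · exact ⟨u i k, fun h => absurd h hi, fun h => absurd h h0, fun h => absurd h h1⟩
  choose M hM hMl hMr using hex
  let u' : ℕ → ℕ → Y := fun i k => if k = 0 then u i 0 else if N ≤ k then u i k else M i (k-1)
  have e0 : ∀ i, u' i 0 = u i 0 := fun i => by simp [u']
  have eN : ∀ i, u' i N = u i N := fun i => by simp [u', hN.ne']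
  have ek : ∀ i k, k + 2 ≤ N → u' i (k+1) = M i k := fun i k hk => by
    simp only [u']; rw [if_neg (by omega), if_neg (by omega)]; rfl
  have cases : ∀ k ≤ N, k = 0 ∨ k = N ∨ ∃ j, k = j + 1 ∧ j + 2 ≤ N := by
    intro k hk
    rcases Nat.eq_zero_or_pos k with h | h
    · exact Or.inl h
    rcases hk.eq_or_lt with h' | h'
    · exact Or.inr (Or.inl h')
    · exact Or.inr (Or.inr ⟨k-1, by omega, by omega⟩)
  have hMh : ∀ i < n, ∀ k, k + 2 ≤ N → D (M i k) (M (i+1) k) ≤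
      (D (u i k) (u (i+1) k) + D (u i (k+2)) (u (i+1) (k+2))) / 2 := by
    intro i hi k hk
    exact hD.bus _ _ _ _ _ _ (h2lt i hi.le k hk) (h2lt (i+1) hi k hk)
      ((h.hor i hi k (by omega)).trans_lt hηlt) (hM i k hi.le hk) (hM (i+1) k hi hk)
  refine ⟨u', ⟨?_, ?_, ?_, ?_, ?_, ?_, ?_⟩⟩
  · intro i hi k hk
    rcases cases k hk with rfl | rfl | ⟨j, rfl, hj⟩
    · rw [e0, e0]; exact h.hor i hi 0 hk
    · rw [eN, eN]; exact h.hor i hi _ hk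
    · rw [ek _ _ hj, ek _ _ hj]
      exact (hMh i hi j hj).trans (half_add hη hη (h.hor i hi j (by omega))
        (h.hor i hi (j+2) (by omega)) (by linarith))
  · intro i hi k hk
    rcases cases k hk.le with rfl | rfl | ⟨j, rfl, hj⟩
    · rcases (Nat.succ_le_of_lt hN).eq_or_lt with h1 | h1
      · have := h.ver i hi 0 hk
        rw [e0]
        have e1 : u' i (0+1) = u i (0+1) := by
          have : 0 + 1 = N := by omega
          rw [this]; exact eN i
        rw [e1]; exact this
      · rw [e0, ek i 0 (by omega)]
        refine (hM i 0 hi (by omega)).1.trans ?_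
        refine (ENNReal.div_le_div_right (h2 i hi 0 (by omega)) 2).trans ?_
        rw [ofReal_half]; exact ENNReal.ofReal_le_ofReal (by linarith)
    · exact absurd hk (lt_irrefl _)
    · rcases (show j + 2 = N ∨ j + 3 ≤ N by omega) with h1 | h1
      · rw [ek i j hj]
        have e1 : u' i (j+1+1) = u i (j+2) := by rw [show j+1+1 = N by omega]; exact eN i
        rw [e1]
        refine (hM i j hi (by omega)).2.trans ?_
        refine (ENNReal.div_le_div_right (h2 i hi j (by omega)) 2).trans ?_
        rw [ofReal_half]; exact ENNReal.ofReal_le_ofReal (by linarith)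
      · rw [ek i j hj, ek i (j+1) (by omega)]
        refine (hD.bus _ _ _ _ _ _ (h2lt i hi j hj) (h2lt i hi (j+1) (by omega))
          ((h.ver i hi j (by omega)).trans_lt hηlt) (hM i j hi hj) (hM i (j+1) hi (by omega))).trans ?_
        exact half_add hη hη (h.ver i hi j (by omega)) (h.ver i hi (j+2) (by omega)) (by linarith)
  · intro k hk
    rcases cases k hk with rfl | rfl | ⟨j, rfl, hj⟩
    · rw [e0]; exact h.left 0 hk
    · rw [eN]; exact h.left _ hk
    · rw [ek _ _ hj]; exact hMl 0 j rfl hj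
  · intro k hk
    rcases cases k hk with rfl | rfl | ⟨j, rfl, hj⟩
    · rw [e0]; exact h.right 0 hk
    · rw [eN]; exact h.right _ hk
    · rw [ek _ _ hj]; exact hMr n j rfl hj
  · intro i hi; rw [e0, e0]; exact h.bot i hi
  · intro i hi; rw [eN, eN]; exact h.top i hi
  · intro i hi k hk
    have hN' : (N:ℝ) ≠ 0 := by exact_mod_cast hN.ne'
    have hpos : ∀ k ≤ N, ∀ m, 0 ≤ η * wt N k * rho N ^ m := fun k hk m =>
      mul_nonneg (mul_nonneg hη (zero_le_one.trans (wt_ge hk))) (pow_nonneg (rho_nonneg N) m)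
    rcases cases k hk with rfl | rfl | ⟨j, rfl, hj⟩
    · rw [e0, e0]
      refine (h.bot i hi).trans (ENNReal.ofReal_le_ofReal ?_)
      have : aff N A B i 0 = A i := by unfold aff; field_simp; simp
      have := hpos 0 hk (m+1)
      linarith
    · rw [eN, eN]
      refine (h.top i hi).trans (ENNReal.ofReal_le_ofReal ?_)
      have : aff k A B i k = B i := by unfold aff; field_simp; simp
      have := hpos k hk (m+1)
      linarith
    · rw [ek _ _ hj, ek _ _ hj]
      refine (hMh i hi j hj).trans (half_add ?_ ?_ (h.est i hi j (by omega))
        (h.est i hi (j+2) (by omega)) ?_)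
      · exact add_nonneg (aff_nonneg (hA i) (hB i) (by omega)) (hpos _ (by omega) _)
      · exact add_nonneg (aff_nonneg (hA i) (hB i) (by omega)) (hpos _ (by omega) _)
      · have h1 := aff_step N A B i j
        have h2 := wt_step N j (by omega)
        have h3 : 0 ≤ η * rho N ^ m := mul_nonneg hη (pow_nonneg (rho_nonneg N) m)
        have h4 := mul_le_mul_of_nonneg_left h2 h3
        rw [pow_succ]
        nlinarith

lemma chain_le (hD : ∀ a, D a a = 0) (ht : ∀ a b c, D a c ≤ D a b + D b c) (v : ℕ → Y) (f : ℕ → ℝ)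
    (n : ℕ) (hf : ∀ i < n, 0 ≤ f i) (h : ∀ i < n, D (v i) (v (i+1)) ≤ ENNReal.ofReal (f i)) :
    D (v 0) (v n) ≤ ENNReal.ofReal (∑ i ∈ Finset.range n, f i) := by
  rw [ENNReal.ofReal_sum_of_nonneg (fun i hi => hf i (Finset.mem_range.1 hi))]
  clear hf
  induction n with
  | zero => simp [hD]
  | succ n ih =>
    rw [Finset.sum_range_succ]
    exact (ht _ (v n) _).trans (add_le_add (ih fun i hi => h i (by omega)) (h n (by omega)))

theorem grid_bound {ε η : ℝ} (hD : MidSp D ε) (hη : 0 ≤ η) (hηε : 2 * η < ε) {n N : ℕ} (hN : 0 < N)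
    (hn : 0 < n) {A B : ℕ → ℝ} (hA : ∀ i, 0 ≤ A i) (hB : ∀ i, 0 ≤ B i) (u : ℕ → ℕ → Y)
    (hl : ∀ k, k + 2 ≤ N → Mid D (u 0 k) (u 0 (k+2)) (u 0 (k+1)))
    (hr : ∀ k, k + 2 ≤ N → Mid D (u n k) (u n (k+2)) (u n (k+1)))
    (hor : ∀ i < n, ∀ k ≤ N, D (u i k) (u (i+1) k) ≤ ENNReal.ofReal η)
    (ver : ∀ i ≤ n, ∀ k < N, D (u i k) (u i (k+1)) ≤ ENNReal.ofReal η)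
    (bot : ∀ i < n, D (u i 0) (u (i+1) 0) ≤ ENNReal.ofReal (A i))
    (top : ∀ i < n, D (u i N) (u (i+1) N) ≤ ENNReal.ofReal (B i)) {ζ : ℝ}
    (hAζ : ∑ i ∈ Finset.range n, A i ≤ ζ) (hBζ : ∑ i ∈ Finset.range n, B i ≤ ζ) :
    ∀ k ≤ N, D (u 0 k) (u n k) ≤ ENNReal.ofReal ζ := by
  have hgood : ∀ m, ∃ u', Good D n N η A B (u 0) (u n) m u' := by
    intro m
    induction m with
    | zero =>
      refine ⟨u, hor, ver, fun _ _ => rfl, fun _ _ => rfl, bot, top, fun i hi k hk => ?_⟩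
      refine (hor i hi k hk).trans (ENNReal.ofReal_le_ofReal ?_)
      have h1 := aff_nonneg (hA i) (hB i) hk
      have h2 := wt_ge hk
      rw [pow_zero, mul_one]
      nlinarith
    | succ m ih =>
      obtain ⟨u', hu'⟩ := ih
      exact good_step hD hη hηε hN hn hA hB hl hr hu'
  intro k hk
  have hpos : ∀ m, 0 ≤ η * wt N k * rho N ^ m := fun m =>
      mul_nonneg (mul_nonneg hη (zero_le_one.trans (wt_ge hk))) (pow_nonneg (rho_nonneg N) m)
  have hb : ∀ m : ℕ, D (u 0 k) (u n k) ≤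
      ENNReal.ofReal (ζ + n * (η * wt N k * rho N ^ m)) := by
    intro m
    obtain ⟨v, hv⟩ := hgood m
    have h1 := chain_le hD.self hD.tri (fun i => v i k)
      (fun i => aff N A B i k + η * wt N k * rho N ^ m) n
      (fun i _ => add_nonneg (aff_nonneg (hA i) (hB i) hk) (hpos m)) (fun i hi => hv.est i hi k hk)
    simp only [hv.left k hk, hv.right k hk] at h1
    refine h1.trans (ENNReal.ofReal_le_ofReal ?_)
    rw [Finset.sum_add_distrib, Finset.sum_const, Finset.card_range, nsmul_eq_mul]
    have hN0 : (0:ℝ) < N := by exact_mod_cast hN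
    have hkN : (k:ℝ) ≤ N := by exact_mod_cast hk
    have e : ∑ i ∈ Finset.range n, aff N A B i k = (((N:ℝ) - k) * ∑ i ∈ Finset.range n, A i +
        k * ∑ i ∈ Finset.range n, B i) / N := by
      unfold aff
      rw [← Finset.sum_div, Finset.sum_add_distrib, Finset.mul_sum, Finset.mul_sum]
    have : ∑ i ∈ Finset.range n, aff N A B i k ≤ ζ := by
      rw [e, div_le_iff₀ hN0]
      have h1 := mul_le_mul_of_nonneg_left hAζ (by linarith : 0 ≤ (N:ℝ) - k)
      have h2 := mul_le_mul_of_nonneg_left hBζ (Nat.cast_nonneg k : (0:ℝ) ≤ k)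
      linarith
    linarith
  have hlim : Filter.Tendsto (fun m : ℕ => ENNReal.ofReal (ζ + n * (η * wt N k * rho N ^ m)))
      Filter.atTop (nhds (ENNReal.ofReal ζ)) := by
    have h0 := tendsto_pow_atTop_nhds_zero_of_lt_one (rho_nonneg N) (rho_lt N)
    have h1 := ((h0.const_mul (η * wt N k)).const_mul (n:ℝ)).const_add ζ
    simp only [mul_zero, add_zero] at h1
    exact ENNReal.tendsto_ofReal h1
  exact ge_of_tendsto' hlim hb

end

end

section
open unitInterval
open Path.Homotopic.Quotient (mk)

lemma contr_I : ContractibleSpace I :=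
  (convex_Icc (0:ℝ) 1).contractibleSpace ⟨0, by simp⟩

instance scI : SimplyConnectedSpace I := by
  have := contr_I
  infer_instance

instance scII : SimplyConnectedSpace (I × I) := by
  have := contr_I
  infer_instance

def idp : Path (0 : I) 1 where
  toFun := id
  continuous_toFun := continuous_id
  source' := rfl
  target' := rfl

def segI (s t : I) : Path s t := subpath idp s t

lemma segI_apply (s t u : I) : ((segI s t u : I) : ℝ) = (1 - u.1) * s.1 + u.1 * t.1 := rfl

lemma segI_mem {s t : I} (h : s ≤ t) (u : I) : segI s t u ∈ Set.Icc s t := by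
  have h' : s.1 ≤ t.1 := h
  have h0 := u.2.1
  have h1 := u.2.2
  constructor
  · show s.1 ≤ (1 - u.1) * s.1 + u.1 * t.1
    nlinarith
  · show (1 - u.1) * s.1 + u.1 * t.1 ≤ t.1
    nlinarith

lemma segI_mono {s t : I} (h : s ≤ t) : Monotone (segI s t) := by
  intro u v huv
  have h' : s.1 ≤ t.1 := h
  have h2 : u.1 ≤ v.1 := huv
  show (1 - u.1) * s.1 + u.1 * t.1 ≤ (1 - v.1) * s.1 + v.1 * t.1
  nlinarith

def vr (g : I → E2) (s t : I) : ENNReal := eVariationOn g (Set.Icc s t)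

lemma vr_add (g : I → E2) {a b c : I} (h : a ≤ b) (h' : b ≤ c) : vr g a b + vr g b c = vr g a c := by
  have := eVariationOn.Icc_add_Icc g (s := Set.univ) h h' trivial
  simpa [vr] using this

lemma Icc01 : Set.Icc (0:I) 1 = Set.univ := by
  ext t; exact ⟨fun _ => trivial, fun _ => ⟨t.2.1, t.2.2⟩⟩

lemma cost_eq_vr {X : Set E2} {a b : X} (γ : Path a b) : cost γ = vr (fun t => (γ t : E2)) 0 1 := by
  unfold cost vr; rw [Icc01]

section
variable {X : Set E2} {T : Type} [TopologicalSpace T] [SimplyConnectedSpace T] (f : C(T, X))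
  {x0 : X} (z0 : T) (q : Path.Homotopic.Quotient x0 (f z0))

def lift (z : T) : UC x0 :=
  ⟨f z, q.trans (mk ((PathConnectedSpace.somePath z0 z).map f.continuous))⟩

lemma lift_class {z z' : T} (γ : Path z z') :
    (lift f z0 q z).2.trans (mk (γ.map f.continuous)) = (lift f z0 q z').2 := by
  simp only [lift]
  rw [Path.Homotopic.Quotient.trans_assoc, ← Path.Homotopic.Quotient.mk_trans, ← Path.map_trans]
  congr 1
  rw [Path.Homotopic.Quotient.eq]
  exact (SimplyConnectedSpace.paths_homotopic _ _).map f

lemma lift_DD_le (j : C(I, T)) {s t : I} (h : s ≤ t) :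
    DD (lift f z0 q (j s)) (lift f z0 q (j t)) ≤ vr (fun u => (f (j u) : E2)) s t := by
  refine (DD_le (((segI s t).map j.continuous).map f.continuous) (lift_class f z0 q _)).trans ?_
  exact eVariationOn.comp_le_of_monotoneOn (fun u => (f (j u) : E2)) (segI s t)
    ((segI_mono h).monotoneOn _) (fun u _ => segI_mem h u)

lemma lift_small (hc : IsCompact X) (hX : PolyU X) {η : ℝ} (hη : 0 < η) : ∃ δ > 0,
    ∀ (j : C(I, T)) (s t : I), s ≤ t → (∀ u ∈ Set.Icc s t, dist (f (j u)) (f (j s)) < δ) →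
      DD (lift f z0 q (j s)) (lift f z0 q (j t)) ≤ ENNReal.ofReal η := by
  obtain ⟨δ, hδ, h⟩ := DD_small (x0 := x0) hc hX hη
  refine ⟨δ, hδ, fun j s t hst hu => ?_⟩
  refine h _ _ (((segI s t).map j.continuous).map f.continuous) (fun u => ?_) (lift_class f z0 q _)
  have := hu _ (segI_mem hst u)
  rw [Subtype.dist_eq, dist_eq_norm] at this
  exact this

lemma opt_aux {X : Set E2} {xs xg y0 y1 : X} (h0 : y0 = xs) (h1 : y1 = xg) (sg : Path xs xg)
    (hopt : IsOptimal sg) (α γ : Path y0 y1) (hα : ∀ t, α t = sg t) (h : α.Homotopic γ) :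
    cost sg ≤ cost γ := by
  subst h0 h1
  have e : α = sg := Path.ext (funext hα)
  rw [← e] at hopt ⊢
  exact hopt _ h

lemma opt_lower (j : C(I, T)) {xs xg : X} (sg : Path xs xg) (hsg : ∀ t, f (j t) = sg t)
    (hopt : IsOptimal sg) (hfin : cost sg ≠ ⊤) {s t : I} (hst : s ≤ t) :
    vr (fun u => (sg u : E2)) s t ≤ DD (lift f z0 q (j s)) (lift f z0 q (j t)) := by
  have hcost : cost sg ≤ DD (lift f z0 q (j 0)) (lift f z0 q (j 1)) := by
    refine le_iInf₂ fun γ hγ => ?_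
    have h0 : f (j 0) = xs := by rw [hsg]; simp
    have h1 : f (j 1) = xg := by rw [hsg]; simp
    exact opt_aux h0 h1 sg hopt ((idp.map j.continuous).map f.continuous) γ hsg
      (class_unique (lift_class f z0 q (idp.map j.continuous)) hγ)
  have hf : (fun u => (f (j u) : E2)) = fun u => (sg u : E2) := by
    funext u; rw [hsg]
  have hle : ∀ {a b : I}, a ≤ b → DD (lift f z0 q (j a)) (lift f z0 q (j b)) ≤
      vr (fun u => (sg u : E2)) a b := by
    intro a b hab
    have := lift_DD_le f z0 q j hab
    rwa [hf] at this
  set g := fun u => (sg u : E2)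
  have e1 : cost sg = vr g 0 s + (vr g s t + vr g t 1) := by
    rw [vr_add g hst t.2.2, vr_add g s.2.1 s.2.2, cost_eq_vr]
  have hA : vr g 0 s ≠ ⊤ := fun h => hfin (by rw [e1, h]; simp)
  have hB : vr g t 1 ≠ ⊤ := fun h => hfin (by rw [e1, h]; simp)
  have h2 := hcost.trans (DD_triangle _ (lift f z0 q (j s)) _)
  have h3 := h2.trans (add_le_add (hle s.2.1) (DD_triangle _ (lift f z0 q (j t)) _))
  have h4 := h3.trans (add_le_add le_rfl (add_le_add le_rfl (hle t.2.2)))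
  rw [e1] at h4
  exact (ENNReal.add_le_add_iff_right hB).1 ((ENNReal.add_le_add_iff_left hA).1 h4)

end

/-- arc length function of an optimal path is continuous -/
lemma arc_continuous {X : Set E2} (hc : IsCompact X) (hX : PolyU X) {xs xg : X} (sg : Path xs xg)
    (hopt : IsOptimal sg) (hfin : cost sg ≠ ⊤) :
    Continuous (fun t : I => (vr (fun u => (sg u : E2)) 0 t).toReal) := by
  set g := fun u => (sg u : E2)
  let f : C(I, X) := sg.toContinuousMap
  have hfn : ∀ {a b : I}, a ≤ b → vr g a b ≠ ⊤ := by
    intro a b hab h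
    apply hfin
    rw [eq_top_iff, ← h]
    exact eVariationOn.mono g (Set.subset_univ _)
  rw [Metric.continuous_iff]
  intro t η hη
  obtain ⟨δ, hδ, hsm⟩ := lift_small f (0:I) (Path.Homotopic.Quotient.refl _) hc hX (half_pos hη)
  have huc := CompactSpace.uniformContinuous_of_continuous sg.continuous
  obtain ⟨ε, hε, hu⟩ := Metric.uniformContinuous_iff.1 huc δ hδ
  refine ⟨ε, hε, fun s hs => ?_⟩
  have key : ∀ a b : I, a ≤ b → dist a b < ε →
      |(vr g 0 a).toReal - (vr g 0 b).toReal| ≤ η / 2 := by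
    intro a b hab hd
    have h1 : vr g a b ≤ ENNReal.ofReal (η / 2) := by
      refine (opt_lower f (0:I) (Path.Homotopic.Quotient.refl _) (ContinuousMap.id I) sg
        (fun _ => rfl) hopt hfin hab).trans ?_
      refine hsm (ContinuousMap.id I) a b hab fun u hu' => hu ?_
      have h1 : a.1 ≤ u.1 := hu'.1
      have h2 : u.1 ≤ b.1 := hu'.2
      have h3 : |a.1 - b.1| < ε := hd
      show |u.1 - a.1| < ε
      rw [abs_of_nonneg (by linarith)]
      rw [abs_sub_comm, abs_of_nonneg (by linarith)] at h3
      linarith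
    have h2 := vr_add g (show (0:I) ≤ a from a.2.1) hab
    have h3 : (vr g 0 b).toReal = (vr g 0 a).toReal + (vr g a b).toReal := by
      rw [← h2, ENNReal.toReal_add (hfn a.2.1) (hfn hab)]
    rw [h3, sub_add_cancel_left, abs_neg, abs_of_nonneg ENNReal.toReal_nonneg]
    exact ENNReal.toReal_le_of_le_ofReal (by positivity) h1
  rw [Real.dist_eq]
  rcases le_total s t with h | h
  · exact (key s t h hs).trans_lt (by linarith)
  · rw [abs_sub_comm]
    exact (key t s h (by rwa [dist_comm])).trans_lt (by linarith)

/-- constant speed reparametrization -/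
lemma exists_reparam {X : Set E2} (hc : IsCompact X) (hX : PolyU X) {xs xg : X} (sg : Path xs xg)
    (hopt : IsOptimal sg) (hfin : cost sg ≠ ⊤) (hpos : cost sg ≠ 0) :
    ∃ (τ : Path xs xg) (φ : I → I), Continuous φ ∧ φ 0 = 0 ∧ φ 1 = 1 ∧ (∀ t, τ (φ t) = sg t) ∧
      cost sg ≤ cost τ ∧ ∃ L : ℝ, 0 ≤ L ∧
      ∀ s t : I, s ≤ t → vr (fun u => (τ u : E2)) s t ≤ ENNReal.ofReal (L * (t.1 - s.1)) ∧
        cost sg = ENNReal.ofReal L := by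
  set g := fun u => (sg u : E2) with hg
  set L := (cost sg).toReal with hL
  have hLpos : 0 < L := ENNReal.toReal_pos hpos hfin
  have hfn : ∀ a b : I, vr g a b ≠ ⊤ := by
    intro a b h
    apply hfin
    rw [eq_top_iff, ← h]
    exact eVariationOn.mono g (Set.subset_univ _)
  have hv : ∀ a b : I, a ≤ b → (vr g 0 b).toReal = (vr g 0 a).toReal + (vr g a b).toReal := by
    intro a b hab
    rw [← vr_add g (show (0:I) ≤ a from a.2.1) hab, ENNReal.toReal_add (hfn _ _) (hfn _ _)]
  have hbd : ∀ t : I, (vr g 0 t).toReal / L ∈ Set.Icc (0:ℝ) 1 := by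
    intro t
    refine ⟨by positivity, ?_⟩
    rw [div_le_one hLpos, hL]
    exact ENNReal.toReal_mono hfin (eVariationOn.mono g (Set.subset_univ _))
  let φ : I → I := fun t => ⟨(vr g 0 t).toReal / L, hbd t⟩
  have hφc : Continuous φ := ((arc_continuous hc hX sg hopt hfin).div_const L).subtype_mk _
  have hφ0 : φ 0 = 0 := by
    apply Subtype.ext
    show (vr g 0 0).toReal / L = 0
    have : vr g 0 0 = 0 := by unfold vr; simp
    rw [this]; simp
  have hφ1 : φ 1 = 1 := by
    apply Subtype.ext
    show (vr g 0 1).toReal / L = 1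
    rw [hg, ← cost_eq_vr]; exact div_self hLpos.ne'
  have hφm : Monotone φ := by
    intro a b hab
    show (vr g 0 a).toReal / L ≤ (vr g 0 b).toReal / L
    rw [hv a b hab]
    gcongr
    linarith [ENNReal.toReal_nonneg (a := vr g a b)]
  have hsurj : Function.Surjective φ := by
    intro y
    have := intermediate_value_Icc (zero_le_one : (0:I) ≤ 1) hφc.continuousOn
    rw [hφ0, hφ1] at this
    obtain ⟨x, _, hx⟩ := this ⟨y.2.1, y.2.2⟩
    exact ⟨x, hx⟩
  have hdist1 : ∀ a b : I, a ≤ b → dist (sg a) (sg b) ≤ L * |(φ a).1 - (φ b).1| := by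
    intro a b hab
    have h1 : edist (g a) (g b) ≤ vr g a b :=
      eVariationOn.edist_le g ⟨le_rfl, hab⟩ ⟨hab, le_rfl⟩
    have h2 : dist (sg a) (sg b) ≤ (vr g a b).toReal := by
      rw [edist_dist] at h1
      exact (ENNReal.ofReal_le_iff_le_toReal (hfn a b)).1 h1
    refine h2.trans ?_
    have h3 := hv a b hab
    have h4 : (φ a).1 - (φ b).1 = - ((vr g a b).toReal / L) := by
      show (vr g 0 a).toReal / L - (vr g 0 b).toReal / L = _
      rw [h3]; ring
    rw [h4, abs_neg, abs_of_nonneg (by positivity)]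
    field_simp; exact le_rfl
  have hdist : ∀ a b : I, dist (sg a) (sg b) ≤ L * |(φ a).1 - (φ b).1| := by
    intro a b
    rcases le_total a b with h | h
    · exact hdist1 a b h
    · rw [dist_comm, abs_sub_comm]; exact hdist1 b a h
  choose ψ hψ using hsurj
  have hlip : ∀ x y : I, dist (sg (ψ x)) (sg (ψ y)) ≤ L * dist x y := by
    intro x y
    have := hdist (ψ x) (ψ y)
    rw [hψ, hψ] at this
    exact this
  have hcomp : ∀ t, sg (ψ (φ t)) = sg t := by
    intro t
    have := hdist (ψ (φ t)) t
    rw [hψ, sub_self, abs_zero, mul_zero] at this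
    exact dist_le_zero.1 this
  have hLip : LipschitzWith (Real.toNNReal L) (fun x => sg (ψ x)) :=
    LipschitzWith.of_dist_le_mul fun x y => by
      rw [Real.coe_toNNReal _ hLpos.le]; exact hlip x y
  refine ⟨⟨⟨fun x => sg (ψ x), hLip.continuous⟩, ?_, ?_⟩, φ, hφc, hφ0, hφ1, hcomp, ?_, L, hLpos.le, ?_⟩
  · have := hcomp 0
    rw [hφ0] at this
    simpa using this
  · have := hcomp 1
    rw [hφ1] at this
    simpa using this
  · have h1 := eVariationOn.comp_le_of_monotoneOn (fun x => (sg (ψ x) : E2)) (s := Set.univ)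
      (t := Set.univ) φ (hφm.monotoneOn _) (Set.mapsTo_univ _ _)
    have h2 : ((fun x => (sg (ψ x) : E2)) ∘ φ) = fun t => (sg t : E2) := by
      funext t; simp [hcomp]
    rw [h2] at h1
    exact h1
  · intro s t hst
    refine ⟨?_, (ENNReal.ofReal_toReal hfin).symm⟩
    have hL2 : LipschitzOnWith (Real.toNNReal L) (fun x => (sg (ψ (Set.projIcc 0 1 zero_le_one x)) : E2))
        Set.univ := by
      rw [lipschitzOnWith_univ]
      refine LipschitzWith.of_dist_le_mul fun x y => ?_
      rw [Real.coe_toNNReal _ hLpos.le]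
      refine (hlip _ _).trans ?_
      gcongr
      have := (LipschitzWith.projIcc (zero_le_one : (0:ℝ) ≤ 1)).dist_le_mul x y
      simpa using this
    have h1 := hL2.comp_eVariationOn_le (g := fun t : I => t.1) (s := Set.Icc s t) (Set.mapsTo_univ _ _)
    have h2 : eVariationOn (fun t : I => t.1) (Set.Icc s t) = ENNReal.ofReal (t.1 - s.1) := by
      have hm : MonotoneOn (fun t : I => t.1) Set.univ := fun s _ t _ h => h
      have := hm.eVariationOn_eq (Set.mem_univ s) (Set.mem_univ t)
      simpa using this
    rw [h2] at h1
    rw [ENNReal.ofReal_mul hLpos.le]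
    refine le_trans (le_of_eq ?_) h1
    unfold vr
    congr 1
    funext x
    simp [Function.comp]


end

section
section
open unitInterval
open Path.Homotopic.Quotient (mk)

def pt (n i : ℕ) : I := ⟨min 1 ((i:ℝ) / n), by positivity, min_le_left _ _⟩

lemma pt_val {n i : ℕ} (hn : 0 < n) (h : i ≤ n) : (pt n i).1 = (i:ℝ) / n := by
  have h0 : (0:ℝ) < n := by exact_mod_cast hn
  have : (i:ℝ) ≤ n := by exact_mod_cast h
  exact min_eq_right ((div_le_one h0).2 this)

lemma pt_zero (n : ℕ) : pt n 0 = 0 := by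
  apply Subtype.ext; simp [pt]

lemma pt_self {n : ℕ} (hn : 0 < n) : pt n n = 1 := by
  apply Subtype.ext
  rw [pt_val hn le_rfl]
  have h0 : (0:ℝ) < n := by exact_mod_cast hn
  simp [h0.ne']

lemma pt_mono (n : ℕ) {i j : ℕ} (h : i ≤ j) : pt n i ≤ pt n j := by
  show min 1 ((i:ℝ) / n) ≤ min 1 ((j:ℝ) / n)
  have : (i:ℝ) ≤ j := by exact_mod_cast h
  gcongr

lemma sum_vr (g : I → E2) (n m : ℕ) :
    ∑ i ∈ Finset.range m, vr g (pt n i) (pt n (i+1)) = vr g 0 (pt n m) := by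
  induction m with
  | zero => rw [pt_zero]; simp [vr]
  | succ m ih =>
    rw [Finset.sum_range_succ, ih, vr_add g (pt n m).2.1 (pt_mono n (Nat.le_succ m))]

lemma sum_vr_toReal (g : I → E2) {n : ℕ} (hn : 0 < n) {ζ : ℝ} (hζ : 0 ≤ ζ)
    (h : vr g 0 1 ≤ ENNReal.ofReal ζ) :
    (∀ a b, vr g a b ≠ ⊤) ∧
    ∑ i ∈ Finset.range n, (vr g (pt n i) (pt n (i+1))).toReal ≤ ζ := by
  have hf : ∀ a b, vr g a b ≠ ⊤ := by
    intro a b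
    refine ne_top_of_le_ne_top (ENNReal.ofReal_ne_top (r := ζ)) (le_trans ?_ h)
    unfold vr; rw [Icc01]; exact eVariationOn.mono g (Set.subset_univ _)
  refine ⟨hf, ?_⟩
  rw [← ENNReal.toReal_sum (fun _ _ => hf _ _), sum_vr, pt_self hn]
  exact ENNReal.toReal_le_of_le_ofReal hζ h

lemma vr_eq {g : I → E2} {L : ℝ} (hL : 0 ≤ L) (h1 : ENNReal.ofReal L ≤ vr g 0 1)
    (h2 : ∀ s t : I, s ≤ t → vr g s t ≤ ENNReal.ofReal (L * (t.1 - s.1))) {s t : I} (hst : s ≤ t) :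
    ENNReal.ofReal (L * (t.1 - s.1)) ≤ vr g s t := by
  rw [← vr_add g s.2.1 s.2.2, ← vr_add g hst t.2.2] at h1
  have h3 := h2 0 s s.2.1
  have h4 := h2 t 1 t.2.2
  have e0 : ((0:I):ℝ) = 0 := rfl
  have e1 : ((1:I):ℝ) = 1 := rfl
  rw [e0, sub_zero] at h3
  rw [e1] at h4
  have hs0 := s.2.1
  have ht1 := t.2.2
  have hst' : s.1 ≤ t.1 := hst
  have e : ENNReal.ofReal L = ENNReal.ofReal (L * s.1) +
      (ENNReal.ofReal (L * (t.1 - s.1)) + ENNReal.ofReal (L * (1 - t.1))) := by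
    rw [← ENNReal.ofReal_add, ← ENNReal.ofReal_add]
    · congr 1; ring
    all_goals positivity
  have h5 := h1.trans (add_le_add h3 (add_le_add le_rfl h4))
  rw [e] at h5
  exact (ENNReal.add_le_add_iff_right ENNReal.ofReal_ne_top).1
    ((ENNReal.add_le_add_iff_left ENNReal.ofReal_ne_top).1 h5)

def rowJ (b : I) : C(I, I × I) := ⟨fun s => (s, b), by fun_prop⟩
def colJ (a : I) : C(I, I × I) := ⟨fun t => (a, t), by fun_prop⟩

lemma grid_app {X : Set E2} (hc : IsCompact X) (hX : PolyU X) (G : C(I × I, X)) {ζ L : ℝ}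
    (hζ : 0 ≤ ζ) (hL : 0 ≤ L) {xs xg : X} (τ : Path xs xg) (hopt : IsOptimal τ)
    (hG1 : ∀ t, G (1, t) = τ t) (hG0 : ∀ t, G (0, t) = G (0, 0))
    (hLc : cost τ = ENNReal.ofReal L)
    (hlip : ∀ s t : I, s ≤ t → vr (fun u => (τ u : E2)) s t ≤ ENNReal.ofReal (L * (t.1 - s.1)))
    (hbot : vr (fun s => (G (s, 0) : E2)) 0 1 ≤ ENNReal.ofReal ζ)
    (htop : vr (fun s => (G (s, 1) : E2)) 0 1 ≤ ENNReal.ofReal ζ) (t : I) :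
    DD (lift G (0, 0) (Path.Homotopic.Quotient.refl _) (0, 0))
      (lift G (0, 0) (Path.Homotopic.Quotient.refl _) (1, t)) ≤ ENNReal.ofReal ζ := by
  set q := Path.Homotopic.Quotient.refl (G (0, 0))
  set l := lift G (0, 0) q with hl
  obtain ⟨ε, hε, hex, hbus⟩ := DD_local (x0 := G (0,0)) hc hX
  have hMS : MidSp (DD (x0 := G (0,0))) ε := ⟨DD_self, DD_triangle, hex, hbus⟩
  have hη : 0 < ε / 3 := by positivity
  obtain ⟨δ, hδ, hsm⟩ := lift_small G (0, 0) q hc hX hη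
  have huc := CompactSpace.uniformContinuous_of_continuous G.continuous
  obtain ⟨ε', hε', hu⟩ := Metric.uniformContinuous_iff.1 huc δ hδ
  -- column facts
  have hleft : ∀ s t : I, s ≤ t → DD (l (0, s)) (l (0, t)) = 0 := by
    intro s t hst
    have := lift_DD_le G (0,0) q (colJ 0) hst
    refine le_antisymm (this.trans ?_) zero_le
    have e : (fun u => (G (colJ 0 u) : E2)) = fun _ => (G (0,0) : E2) := by
      funext u
      exact congrArg Subtype.val (hG0 u)
    rw [e]
    unfold vr
    exact (eVariationOn.constant_on (by rintro x ⟨_, _, rfl⟩ y ⟨_, _, rfl⟩; rfl)).le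
  have eτ : (fun u => (G (colJ 1 u) : E2)) = fun u => (τ u : E2) := by
    funext u
    exact congrArg Subtype.val (hG1 u)
  have hright : ∀ s t : I, s ≤ t → DD (l (1, s)) (l (1, t)) ≤ ENNReal.ofReal (L * (t.1 - s.1)) := by
    intro s t hst
    have := lift_DD_le G (0,0) q (colJ 1) hst
    rw [eτ] at this
    exact this.trans (hlip s t hst)
  have hright' : ∀ s t : I, s ≤ t → ENNReal.ofReal (L * (t.1 - s.1)) ≤ DD (l (1, s)) (l (1, t)) := by
    intro s t hst
    refine (vr_eq hL ?_ hlip hst).trans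
      (opt_lower G (0,0) q (colJ 1) τ hG1 hopt (by rw [hLc]; exact ENNReal.ofReal_ne_top) hst)
    rw [← hLc, cost_eq_vr]
  apply ENNReal.le_of_forall_pos_le_add
  intro e he _
  obtain ⟨N, hN⟩ := exists_nat_gt (max (1 / ε') (L / e))
  have he' : (0:ℝ) < e := he
  have hNpos' : (0:ℝ) < N := lt_of_le_of_lt (le_max_of_le_left (by positivity)) hN
  have hNpos : 0 < N := by exact_mod_cast hNpos'
  have hN1 : 1 / (N:ℝ) < ε' := by
    rw [div_lt_comm₀ hNpos' hε']
    exact (le_max_left _ _).trans_lt hN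
  have hN2 : L / N ≤ e := by
    have := (le_max_right _ _).trans_lt hN
    rw [div_lt_iff₀ he'] at this
    rw [div_le_iff₀ hNpos']; linarith
  have hstep : ∀ i, i < N → ∀ u ∈ Set.Icc (pt N i) (pt N (i+1)), dist u (pt N i) < ε' := by
    intro i hi u hu'
    have h1 : (pt N i).1 ≤ u.1 := hu'.1
    have h2 : u.1 ≤ (pt N (i+1)).1 := hu'.2
    rw [pt_val hNpos hi] at h2
    have h3 := pt_val hNpos hi.le
    show |u.1 - (pt N i).1| < ε'
    rw [abs_of_nonneg (by linarith), h3]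
    push_cast at h2
    rw [add_div] at h2
    linarith
  obtain ⟨hfA, hsA⟩ := sum_vr_toReal _ hNpos hζ hbot
  obtain ⟨hfB, hsB⟩ := sum_vr_toReal _ hNpos hζ htop
  have key : ∀ k ≤ N, DD (l (0, pt N k)) (l (1, pt N k)) ≤ ENNReal.ofReal ζ := by
    have := grid_bound (D := DD (x0 := G (0,0))) (η := ε / 3) hMS hη.le (by linarith) hNpos hNpos
      (A := fun i => (vr (fun s => (G (s, 0) : E2)) (pt N i) (pt N (i+1))).toReal)
      (B := fun i => (vr (fun s => (G (s, 1) : E2)) (pt N i) (pt N (i+1))).toReal)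
      (fun _ => ENNReal.toReal_nonneg) (fun _ => ENNReal.toReal_nonneg)
      (fun i k => l (pt N i, pt N k)) ?_ ?_ ?_ ?_ ?_ ?_ hsA hsB
    · intro k hk
      have := this k hk
      rwa [pt_zero, pt_self hNpos] at this
    · intro k hk
      rw [pt_zero]
      constructor
      · rw [hleft _ _ (pt_mono N (by omega))]; exact zero_le
      · rw [hleft _ _ (pt_mono N (by omega))]; exact zero_le
    · intro k hk
      rw [pt_self hNpos]
      have h0 := pt_val hNpos (show k ≤ N by omega)
      have h1 := pt_val hNpos (show k+1 ≤ N by omega)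
      have h2 := pt_val hNpos (show k+2 ≤ N by omega)
      have h3 := hright' _ _ (pt_mono N (show k ≤ k+2 by omega))
      have h4 : ENNReal.ofReal (L / N) ≤ DD (l (1, pt N k)) (l (1, pt N (k+2))) / 2 := by
        refine le_trans (le_of_eq ?_) (ENNReal.div_le_div_right h3 2)
        rw [ofReal_half]
        congr 1
        rw [h0, h2]; push_cast; field_simp; ring
      constructor
      · refine le_trans (hright _ _ (pt_mono N (by omega))) (le_trans (le_of_eq ?_) h4)
        congr 1
        rw [h0, h1]; push_cast; field_simp; ring
      · refine le_trans (hright _ _ (pt_mono N (by omega))) (le_trans (le_of_eq ?_) h4)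
        congr 1
        rw [h1, h2]; push_cast; field_simp; ring
    · intro i hi k hk
      refine hsm (rowJ (pt N k)) (pt N i) (pt N (i+1)) (pt_mono N (by omega)) fun u hu' => hu ?_
      show dist (u, pt N k) (pt N i, pt N k) < ε'
      rw [Prod.dist_eq, dist_self]
      exact max_lt (hstep i hi u hu') hε'
    · intro i hi k hk
      refine hsm (colJ (pt N i)) (pt N k) (pt N (k+1)) (pt_mono N (by omega)) fun u hu' => hu ?_
      show dist (pt N i, u) (pt N i, pt N k) < ε'
      rw [Prod.dist_eq, dist_self]
      exact max_lt hε' (hstep k hk u hu')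
    · intro i hi
      rw [pt_zero]
      rw [ENNReal.ofReal_toReal (hfA _ _)]
      exact lift_DD_le G (0,0) q (rowJ 0) (pt_mono N (by omega))
    · intro i hi
      rw [pt_self hNpos]
      rw [ENNReal.ofReal_toReal (hfB _ _)]
      exact lift_DD_le G (0,0) q (rowJ 1) (pt_mono N (by omega))
  have ht0 := t.2.1
  have ht1 := t.2.2
  set k := ⌊t.1 * N⌋₊ with hk
  have hk1 : (k:ℝ) ≤ t.1 * N := Nat.floor_le (by positivity)
  have hk2 : t.1 * N < k + 1 := Nat.lt_floor_add_one _
  have hkN : k ≤ N := by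
    have : (k:ℝ) ≤ N := hk1.trans (by nlinarith)
    exact_mod_cast this
  have hp := pt_val hNpos hkN
  have hle : pt N k ≤ t := by
    show (pt N k).1 ≤ t.1
    rw [hp, div_le_iff₀ hNpos']; exact hk1
  have c1 : DD (l (0, 0)) (l (0, pt N k)) = 0 := hleft _ _ (pt N k).2.1
  have c3 : DD (l (1, pt N k)) (l (1, t)) ≤ e := by
    refine (hright _ _ hle).trans ?_
    rw [← ENNReal.ofReal_coe_nnreal]
    apply ENNReal.ofReal_le_ofReal
    refine le_trans ?_ hN2
    rw [hp, le_div_iff₀ hNpos']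
    have : L * (t.1 - k / N) * N = L * (t.1 * N - k) := by field_simp
    rw [this]; nlinarith
  calc DD (l (0, 0)) (l (1, t)) ≤ DD (l (0,0)) (l (0, pt N k)) + DD (l (0, pt N k)) (l (1, t)) :=
        DD_triangle _ _ _
    _ = DD (l (0, pt N k)) (l (1, t)) := by rw [c1, zero_add]
    _ ≤ DD (l (0, pt N k)) (l (1, pt N k)) + DD (l (1, pt N k)) (l (1, t)) := DD_triangle _ _ _
    _ ≤ _ := add_le_add (key k hkN) c3

def dbl (s : I) : I := ⟨min 1 (2 * s.1), le_min zero_le_one (mul_nonneg zero_le_two s.2.1), min_le_left _ _⟩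

lemma dbl_cont : Continuous dbl := Continuous.subtype_mk (by fun_prop) _
lemma dbl_mono : Monotone dbl := by
  intro a b h
  have : a.1 ≤ b.1 := h
  show min 1 (2 * a.1) ≤ min 1 (2 * b.1)
  gcongr
lemma dbl_zero : dbl 0 = 0 := by apply Subtype.ext; simp [dbl]
lemma dbl_one : dbl 1 = 1 := by apply Subtype.ext; simp [dbl]

lemma exists_G {Y : Type*} [TopologicalSpace Y] {x0 xs xg : Y} (α : Path x0 xs) (β : Path x0 xg)
    (τ : Path xs xg) (h : τ.Homotopic (α.symm.trans β)) :
    ∃ G : C(I × I, Y), (∀ t, G (0, t) = x0) ∧ (∀ t, G (1, t) = τ t) ∧ (∀ s, G (s, 0) = α (dbl s)) ∧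
      (∀ s, G (s, 1) = β (dbl s)) := by
  obtain ⟨K⟩ := h
  have hm : ∀ s t : I, 1/2 + (dbl s).1 * (t.1 - 1/2) ∈ Set.Icc (0:ℝ) 1 := by
    intro s t
    have h1 := (dbl s).2.1
    have h2 := (dbl s).2.2
    have h3 := t.2.1
    have h4 := t.2.2
    constructor <;> nlinarith
  let c1 : I × I → I := fun z => dbl (σ z.1)
  let c2 : I × I → I := fun z => ⟨1/2 + (dbl z.1).1 * (z.2.1 - 1/2), hm z.1 z.2⟩
  have hc1 : Continuous c1 := dbl_cont.comp (continuous_symm.comp continuous_fst)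
  have hc2 : Continuous c2 := by
    refine Continuous.subtype_mk ?_ _
    have := dbl_cont
    fun_prop
  have hlo : ∀ s t : I, s.1 ≤ 1/2 → K (c1 (s, t), c2 (s, t)) = (α.symm.trans β) (c2 (s,t)) := by
    intro s t hs
    have e : c1 (s, t) = 1 := by
      apply Subtype.ext
      show min 1 (2 * (1 - s.1)) = 1
      exact min_eq_left (by linarith)
    rw [e]; exact K.apply_one _
  refine ⟨⟨fun z => K (c1 z, c2 z), K.continuous.comp (hc1.prodMk hc2)⟩, ?_, ?_, ?_, ?_⟩
  · intro t
    show K (c1 (0, t), c2 (0, t)) = x0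
    rw [hlo 0 t (by norm_num), Path.trans_apply]
    have e : (c2 (0, t)).1 = 1/2 := by
      show 1/2 + (dbl 0).1 * (t.1 - 1/2) = 1/2
      rw [dbl_zero]; simp
    rw [dif_pos e.le]
    simp [e]
  · intro t
    show K (c1 (1, t), c2 (1, t)) = τ t
    have e1 : c1 (1, t) = 0 := by
      show dbl (σ 1) = 0
      rw [symm_one, dbl_zero]
    have e2 : c2 (1, t) = t := by
      apply Subtype.ext
      show 1/2 + (dbl 1).1 * (t.1 - 1/2) = t.1
      rw [dbl_one]; simp
    rw [e1, e2]; exact K.apply_zero _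
  · intro s
    show K (c1 (s, 0), c2 (s, 0)) = α (dbl s)
    have e2 : (c2 (s, 0)).1 = 1/2 - (dbl s).1 / 2 := by
      show 1/2 + (dbl s).1 * ((0:ℝ) - 1/2) = _
      ring
    rcases le_total s.1 (1/2) with hs | hs
    · rw [hlo s 0 hs, Path.trans_apply, dif_pos (by rw [e2]; linarith [(dbl s).2.1]), Path.symm_apply]
      refine congrArg α (Subtype.ext ?_)
      show 1 - 2 * (c2 (s,0)).1 = (dbl s).1
      rw [e2]; ring
    · have e3 : dbl s = 1 := by
        apply Subtype.ext
        show min 1 (2 * s.1) = 1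
        exact min_eq_left (by linarith)
      have e4 : c2 (s, 0) = 0 := by
        apply Subtype.ext
        rw [e2, e3]; simp
      rw [e4, K.source, e3, α.target]
  · intro s
    show K (c1 (s, 1), c2 (s, 1)) = β (dbl s)
    have e2 : (c2 (s, 1)).1 = 1/2 + (dbl s).1 / 2 := by
      show 1/2 + (dbl s).1 * ((1:ℝ) - 1/2) = _
      ring
    rcases le_total s.1 (1/2) with hs | hs
    · rw [hlo s 1 hs, Path.trans_apply]
      split_ifs with h
      · have e3 : (dbl s).1 = 0 := le_antisymm (by rw [e2] at h; linarith) (dbl s).2.1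
        have e4 : dbl s = 0 := Subtype.ext e3
        rw [e4, β.source]
        simp [e2, e3]
      · congr 1
        apply Subtype.ext
        show 2 * (c2 (s,1)).1 - 1 = (dbl s).1
        rw [e2]; ring
    · have e3 : dbl s = 1 := by
        apply Subtype.ext
        show min 1 (2 * s.1) = 1
        exact min_eq_left (by linarith)
      have e4 : c2 (s, 1) = 1 := by
        apply Subtype.ext
        rw [e2, e3]; norm_num
      rw [e4, K.target, e3, β.target]

lemma mCost_le {X : Set E2} {a b : X} (p p' : Path a b) (h : p.Homotopic p') : mCost p ≤ cost p' :=
  iInf_le (fun s : {s : Path a b // p.Homotopic s} => cost s.1) ⟨p', h⟩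

lemma fin_aux {X : Set E2} {a b c a' b' c' : X} (ha : a' = a) (hb : b' = b) (hc : c' = c)
    (α : Path a b) (β : Path b c) (α' : Path a' b') (β' : Path b' c') (γ : Path a' c')
    (hα : ∀ s, α' s = α (dbl s)) (hβ : ∀ s, β' s = β s) (h : (α'.trans β').Homotopic γ) :
    mCost (α.trans β) ≤ cost γ := by
  subst ha hb hc
  have e1 : β' = β := Path.ext (funext hβ)
  have e2 : α' = α.reparam dbl dbl_cont dbl_zero dbl_one := Path.ext (funext hα)
  apply mCost_le
  refine Path.Homotopic.trans ?_ h
  rw [e1, e2]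
  exact Path.Homotopic.hcomp ⟨Path.Homotopy.reparam α dbl dbl_cont dbl_zero dbl_one⟩ (Path.Homotopic.refl _)

lemma final_bound {X : Set E2} (G : C(I × I, X)) {x0 xs xg : X} (α : Path x0 xs) (s' : Path xs xg)
    (hG0 : G (0, 0) = x0) (hα : ∀ s, G (s, 0) = α (dbl s)) (φ : I → I) (hφ : Continuous φ)
    (hφ0 : φ 0 = 0) (hs : ∀ t, G (1, φ t) = s' t) (t : I) :
    mCost (α.trans (subpath0 s' t)) ≤
      DD (lift G (0, 0) (Path.Homotopic.Quotient.refl _) (0, 0))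
      (lift G (0, 0) (Path.Homotopic.Quotient.refl _) (1, φ t)) := by
  refine le_iInf₂ fun γ hγ => ?_
  let p1 : Path ((0,0) : I × I) (1, 0) := idp.map (rowJ 0).continuous
  have hcol : Continuous (fun u => ((1, φ u) : I × I)) := by fun_prop
  let p2 : Path ((1,0) : I × I) (1, φ t) := ((segI 0 t).map hcol).cast (by rw [hφ0]) rfl
  have h1 := class_unique (lift_class G (0,0) _ (p1.trans p2)) hγ
  rw [Path.map_trans] at h1
  refine fin_aux hG0 ?_ (hs t) α (subpath0 s' t) (p1.map G.continuous) (p2.map G.continuous) γ hα ?_ h1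
  · rw [hα 1, dbl_one, α.target]
  · intro u
    exact hs (segI 0 t u)

end

end

/-- if both configurations `ς_s` and `ς_g` have cost at most ζ and `σ*`
is an optimal homotopic path with `σ* ≃_p ς̄_s * ς_g`, then moving along `σ*` keeps the
taut tether length within ζ: `m[ς_s * σ*_{[0,t]}] ≤ ζ` for all t. -/
theorem tether_bound_along_optimal_path {X : Set E2} (hcomp : IsCompact X)
    (hpc : IsPathConnected X)
    (hpoly : ∃ (n : ℕ) (P : Fin n → Finset E2), X = ⋃ i, convexHull ℝ (↑(P i) : Set E2))
    {ζ : ℝ} (hζ : 0 ≤ ζ) {xstar xs xg : X}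
    (ςs : Path xstar xs) (ςg : Path xstar xg)
    (hcs : cost ςs ≤ ENNReal.ofReal ζ) (hcg : cost ςg ≤ ENNReal.ofReal ζ)
    (σstar : Path xs xg) (hopt : IsOptimal σstar)
    (hhom : σstar.Homotopic (ςs.symm.trans ςg)) :
    ∀ t : unitInterval, mCost (ςs.trans (subpath0 σstar t)) ≤ ENNReal.ofReal ζ := by
  have hfin : cost σstar ≠ ⊤ := by
    have h1 := (hopt _ hhom).trans (cost_trans _ _)
    rw [cost_symm] at h1
    exact ne_top_of_le_ne_top (ENNReal.add_ne_top.2 ⟨ENNReal.ofReal_ne_top, ENNReal.ofReal_ne_top⟩)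
      (h1.trans (add_le_add hcs hcg))
  intro t
  by_cases h0 : cost σstar = 0
  · refine (mCost_le _ _ (Path.Homotopic.refl _)).trans ((cost_trans _ _).trans ?_)
    have h1 : cost (subpath0 σstar t) ≤ cost σstar :=
      eVariationOn.comp_le_of_monotoneOn (fun u => (σstar u : E2)) (segI 0 t)
        ((segI_mono t.2.1).monotoneOn _) (Set.mapsTo_univ _ _)
    rw [h0] at h1
    exact (add_le_add hcs h1).trans (by simp)
  obtain ⟨τ, φ, hφ, hφ0, hφ1, hτ, hle, L, hL, hlip⟩ := exists_reparam hcomp hpoly σstar hopt hfin h0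
  have hcL : cost σstar = ENNReal.ofReal L := (hlip 0 1 zero_le_one).2
  have e : σstar = τ.reparam φ hφ hφ0 hφ1 := Path.ext (funext fun u => (hτ u).symm)
  have hh : τ.Homotopic σstar := by
    rw [e]; exact ⟨Path.Homotopy.reparam τ φ hφ hφ0 hφ1⟩
  have hcτ : cost τ = ENNReal.ofReal L := by
    apply le_antisymm
    · rw [cost_eq_vr]
      have := (hlip 0 1 zero_le_one).1
      simpa using this
    · rw [← hcL]; exact hle
  have hoptτ : IsOptimal τ := by
    intro p hp
    rw [hcτ, ← hcL]
    exact hopt _ (hh.symm.trans hp)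
  obtain ⟨G, g0, g1, gb, gt⟩ := exists_G ςs ςg τ (hh.trans hhom)
  have hrow : ∀ {y : X} (p : Path xstar y), cost p ≤ ENNReal.ofReal ζ →
      vr (fun s => (p (dbl s) : E2)) 0 1 ≤ ENNReal.ofReal ζ := by
    intro y p hp
    refine le_trans ?_ hp
    exact eVariationOn.comp_le_of_monotoneOn (fun u => (p u : E2)) dbl
      (dbl_mono.monotoneOn _) (Set.mapsTo_univ _ _)
  refine (final_bound G ςs σstar (g0 0) gb φ hφ hφ0 (fun u => by rw [g1, hτ]) t).trans ?_
  refine grid_app hcomp hpoly G hζ hL τ hoptτ g1 (fun u => by rw [g0, g0]) hcτ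
    (fun s t hst => (hlip s t hst).1) ?_ ?_ (φ t)
  · simp_rw [gb]; exact hrow ςs hcs
  · simp_rw [gt]; exact hrow ςg hcg

end THPP
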